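/- arXiv:2011.01692 — 3 statements merged into one kernel-verified Lean document; each statement's English description precedes it below -/
import Mathlib

section
/- Let α ∈ [0,1], β = √(1−α²), c > 0, and let m_{c,α} be the expander profile with limit vector A⁺_{c,α} = (Aⱼ⁺)ⱼ at +∞. Set s₀ = 4√(8+c²) and B⁺ = ((1−(A₁⁺)²)^{1/2}, (1−(A₂⁺)²)^{1/2}, (1−(A₃⁺)²)^{1/2}). Then there exist constants a₁, a₂, a₃ ∈ [0,2π) and a constant C(c) > 0 depending only on c (not on α) such that, defining φⱼ(s) = aⱼ + β ∫_{s₀²/4}^{s²/4} √(1 + c² e^{−2ασ}/σ) dσ for j = 1,2,3, each component of m_{c,α} satisfies for all s ≥ s₀: | m_{j,c,α}(s) − Aⱼ⁺ + (2c/s) Bⱼ⁺ e^{−αs²/4}( α sin(φⱼ(s)) + β cos(φⱼ(s)) ) + (2c²/s²) Aⱼ⁺ e^{−αs²/2} | ≤ C(c) e^{−αs²/4} / s³. -/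
noncomputable section

open Real MeasureTheory Filter Topology

/-- `E3` is `ℝ³` with the Euclidean norm. -/
abbrev E3 : Type := EuclideanSpace ℝ (Fin 3)

def toE3 (v : Fin 3 → ℝ) : E3 := (WithLp.equiv 2 (Fin 3 → ℝ)).symm v

def e1 : E3 := EuclideanSpace.single 0 1
def e2 : E3 := EuclideanSpace.single 1 1
def e3 : E3 := EuclideanSpace.single 2 1

/-- `(m, n, b)` solves the Serret–Frenet system with curvature `k(x) = c e^{-αx²/4}`,
torsion `τ(x) = βx/2` and initial conditions `(e₁, e₂, e₃)`. -/
def IsSF (α β c : ℝ) (m n b : ℝ → E3) : Prop :=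
  (∀ x : ℝ, HasDerivAt m ((c * Real.exp (-α * x ^ 2 / 4)) • n x) x) ∧
  (∀ x : ℝ, HasDerivAt n
    ((-(c * Real.exp (-α * x ^ 2 / 4))) • m x + (β * x / 2) • b x) x) ∧
  (∀ x : ℝ, HasDerivAt b ((-(β * x / 2)) • n x) x) ∧
  m 0 = e1 ∧ n 0 = e2 ∧ b 0 = e3

/-- The phase function `φⱼ(s) = aⱼ + β ∫_{s₀²/4}^{s²/4} √(1 + c² e^{-2ασ}/σ) dσ`. -/
def phase (α β c a : ℝ) (s : ℝ) : ℝ :=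
  a + β * ∫ σ in ((4 * Real.sqrt (8 + c ^ 2)) ^ 2 / 4)..(s ^ 2 / 4),
    Real.sqrt (1 + c ^ 2 * Real.exp (-2 * α * σ) / σ)

/-- Mean value inequality with a majorant: `‖F'‖ ≤ -g'` bounds the increments of `F` by those
of `g`. -/
lemma norm_sub_le_sub_of_deriv_le {E : Type*} [NormedAddCommGroup E] [NormedSpace ℝ E]
    {F F' : ℝ → E} {g g' : ℝ → ℝ} {s t : ℝ} (hst : s ≤ t)
    (hF : ∀ x, s ≤ x → HasDerivAt F (F' x) x) (hg : ∀ x, s ≤ x → HasDerivAt g (g' x) x)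
    (hb : ∀ x, s ≤ x → ‖F' x‖ ≤ -g' x) : ‖F t - F s‖ ≤ g s - g t := by
  refine image_norm_le_of_norm_deriv_right_le_deriv_boundary' (a := s) (b := t)
    (f := fun x => F x - F s) (f' := F') (B := fun x => g s - g x) (B' := fun x => -g' x)
    ?_ ?_ (by simp) ?_ ?_ ?_ (Set.right_mem_Icc.2 hst)
  · exact fun x hx => ((hF x hx.1).sub_const _).continuousAt.continuousWithinAt
  · exact fun x hx => ((hF x hx.1).sub_const _).hasDerivWithinAt
  · exact fun x hx => ((hg x hx.1).const_sub _).continuousAt.continuousWithinAt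
  · exact fun x hx => ((hg x hx.1).const_sub _).hasDerivWithinAt
  · exact fun x hx => hb x hx.1

lemma norm_sub_le_of_deriv_le_of_tendsto {E : Type*} [NormedAddCommGroup E] [NormedSpace ℝ E]
    {F F' : ℝ → E} {g g' : ℝ → ℝ} {s : ℝ} {L : E}
    (hF : ∀ x, s ≤ x → HasDerivAt F (F' x) x) (hg : ∀ x, s ≤ x → HasDerivAt g (g' x) x)
    (hb : ∀ x, s ≤ x → ‖F' x‖ ≤ -g' x) (hg0 : ∀ x, s ≤ x → 0 ≤ g x)
    (hL : Tendsto F atTop (𝓝 L)) : ‖F s - L‖ ≤ g s := by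
  rw [norm_sub_rev]
  refine le_of_tendsto ((hL.sub_const (F s)).norm) ?_
  filter_upwards [eventually_ge_atTop s] with t ht
  linarith [norm_sub_le_sub_of_deriv_le ht hF hg hb, hg0 t ht]

/-- A function whose derivative is dominated by that of a decaying majorant has a limit, with
rate. -/
lemma exists_norm_sub_le_of_deriv_le {E : Type*} [NormedAddCommGroup E] [NormedSpace ℝ E]
    [CompleteSpace E] {F F' : ℝ → E} {g g' : ℝ → ℝ} {s₀ : ℝ}
    (hF : ∀ x, s₀ ≤ x → HasDerivAt F (F' x) x) (hg : ∀ x, s₀ ≤ x → HasDerivAt g (g' x) x)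
    (hb : ∀ x, s₀ ≤ x → ‖F' x‖ ≤ -g' x) (hg0 : ∀ x, s₀ ≤ x → 0 ≤ g x)
    (hlim : Tendsto g atTop (𝓝 0)) :
    ∃ L, Tendsto F atTop (𝓝 L) ∧ ∀ s, s₀ ≤ s → ‖F s - L‖ ≤ g s := by
  have incr : ∀ s t, s₀ ≤ s → s ≤ t → ‖F t - F s‖ ≤ g s - g t := fun s t hs hst =>
    norm_sub_le_sub_of_deriv_le hst (fun x hx => hF x (hs.trans hx))
      (fun x hx => hg x (hs.trans hx)) (fun x hx => hb x (hs.trans hx))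
  have hc : Cauchy (map F atTop) := by
    rw [Metric.cauchy_iff]
    refine ⟨inferInstance, fun ε hε => ?_⟩
    obtain ⟨T, hT, hT0⟩ := ((hlim.eventually_lt_const (half_pos hε)).and
      (eventually_ge_atTop s₀)).exists
    refine ⟨F '' Set.Ici T, image_mem_map (Ici_mem_atTop T), ?_⟩
    rintro _ ⟨x, hx, rfl⟩ _ ⟨y, hy, rfl⟩
    have h1 := incr T x hT0 hx
    have h2 := incr T y hT0 hy
    have h3 := hg0 x (hT0.trans hx)
    have h4 := hg0 y (hT0.trans hy)
    rw [← dist_eq_norm] at h1 h2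
    have := dist_triangle_right (F x) (F y) (F T)
    linarith
  obtain ⟨L, hL⟩ := CompleteSpace.complete hc
  exact ⟨L, hL, fun s hs => norm_sub_le_of_deriv_le_of_tendsto (fun x hx => hF x (hs.trans hx))
      (fun x hx => hg x (hs.trans hx)) (fun x hx => hb x (hs.trans hx))
      (fun x hx => hg0 x (hs.trans hx)) hL⟩

/-- The curvature `c e^{-αx²/4}`. -/
def curv (α c x : ℝ) : ℝ := c * Real.exp (-α * x ^ 2 / 4)

/-- One coordinate `(mⱼ, nⱼ, bⱼ)` of a solution of the Serret–Frenet system. -/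
structure IsCoordSF (α β c : ℝ) (m n b : ℝ → ℝ) : Prop where
  deriv_m : ∀ x, HasDerivAt m (curv α c x * n x) x
  deriv_n : ∀ x, HasDerivAt n (-curv α c x * m x + β * x / 2 * b x) x
  deriv_b : ∀ x, HasDerivAt b (-(β * x / 2) * n x) x
  sq_add : ∀ x, m x ^ 2 + n x ^ 2 + b x ^ 2 = 1

lemma hasDerivAt_curv (α c x : ℝ) :
    HasDerivAt (curv α c) (-(α * x / 2) * curv α c x) x := by
  have h : HasDerivAt (fun y : ℝ => -α * y ^ 2 / 4) (-(α * x / 2)) x := by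
    refine (((hasDerivAt_pow 2 x).const_mul (-α)).div_const 4).congr_deriv ?_
    push_cast; ring
  refine ((h.exp).const_mul c).congr_deriv ?_
  unfold curv
  ring

lemma curv_pos {c : ℝ} (hc : 0 < c) (α x : ℝ) : 0 < curv α c x := by unfold curv; positivity

lemma curv_le {α c : ℝ} (hc : 0 < c) (hα : 0 ≤ α) (x : ℝ) : curv α c x ≤ c := by
  unfold curv
  have : Real.exp (-α * x ^ 2 / 4) ≤ 1 := Real.exp_le_one_iff.2 (by nlinarith [sq_nonneg x])
  nlinarith

lemma mul_curv_mul_sq_le {c : ℝ} (hc : 0 < c) (α x : ℝ) :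
    α * curv α c x * x ^ 2 ≤ 4 * c := by
  unfold curv
  have h1 := Real.add_one_le_exp (α * x ^ 2 / 4)
  have h2 : Real.exp (-α * x ^ 2 / 4) * Real.exp (α * x ^ 2 / 4) = 1 := by
    rw [← Real.exp_add, show -α * x ^ 2 / 4 + α * x ^ 2 / 4 = 0 by ring, Real.exp_zero]
  have h3 := Real.exp_pos (-α * x ^ 2 / 4)
  have : Real.exp (-α * x ^ 2 / 4) * (α * x ^ 2 / 4) ≤ 1 := by
    rw [← h2]; gcongr; linarith
  nlinarith

lemma IsCoordSF.abs_le_one {α β c : ℝ} {m n b : ℝ → ℝ} (h : IsCoordSF α β c m n b) (x : ℝ) :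
    |m x| ≤ 1 ∧ |n x| ≤ 1 ∧ |b x| ≤ 1 := by
  have := h.sq_add x
  refine ⟨?_, ?_, ?_⟩ <;> refine abs_le_one_iff_mul_self_le_one.2 ?_ <;>
    nlinarith [sq_nonneg (m x), sq_nonneg (n x), sq_nonneg (b x)]

lemma hasDerivAt_inv_real {x : ℝ} (hx : x ≠ 0) :
    HasDerivAt (fun y : ℝ => y⁻¹) (-(x⁻¹) ^ 2) x := by
  simpa using hasDerivAt_inv hx

lemma IsCoordSF.abs_combination_le {α β c : ℝ} {m n b : ℝ → ℝ} (h : IsCoordSF α β c m n b)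
    {p q : ℝ} (hp : |p| ≤ 1) (hq : |q| ≤ 1) (x : ℝ) : |p * n x + q * b x| ≤ 2 := by
  obtain ⟨-, h2, h3⟩ := h.abs_le_one x
  calc _ ≤ |p| * |n x| + |q| * |b x| := by
        rw [← abs_mul, ← abs_mul]; exact abs_add_le _ _
    _ ≤ 1 * 1 + 1 * 1 := by gcongr
    _ = 2 := by norm_num

lemma abs_le_one_of_sq_add_sq {α β : ℝ} (h : α ^ 2 + β ^ 2 = 1) : |α| ≤ 1 ∧ |β| ≤ 1 :=
  ⟨abs_le_one_iff_mul_self_le_one.2 (by nlinarith [sq_nonneg β]),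
    abs_le_one_iff_mul_self_le_one.2 (by nlinarith [sq_nonneg α])⟩

lemma abs_sq_coeff_le_one {α β : ℝ} (h : α ^ 2 + β ^ 2 = 1) :
    |α ^ 2 - β ^ 2| ≤ 1 ∧ |2 * α * β| ≤ 1 :=
  ⟨abs_le.2 ⟨by nlinarith [sq_nonneg α], by nlinarith [sq_nonneg β]⟩,
    abs_le.2 ⟨by nlinarith [sq_nonneg (α + β)], by nlinarith [sq_nonneg (α - β)]⟩⟩

/-- Second order expansion of `m - A` in terms of the frame, obtained by repeated integration by
parts: the corrected function has derivative `O(k/x⁴)`. -/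
lemma IsCoordSF.abs_sub_le {α β c : ℝ} (hc : 0 < c) (hα : 0 ≤ α) (hαβ : α ^ 2 + β ^ 2 = 1)
    {m n b : ℝ → ℝ} (h : IsCoordSF α β c m n b) {A : ℝ} (hA : Tendsto m atTop (𝓝 A))
    {s : ℝ} (hs : 1 ≤ s) :
    |m s + 2 * s⁻¹ * curv α c s * (α * n s + β * b s) - 2 * m s * curv α c s ^ 2 * s⁻¹ ^ 2
      - 4 * curv α c s * s⁻¹ ^ 3 * ((α ^ 2 - β ^ 2) * n s + 2 * α * β * b s)
      - 4 * curv α c s ^ 3 * s⁻¹ ^ 3 * (α * n s + β * b s) - A|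
      ≤ (24 + 32 * c + 72 * c ^ 2 + 16 * c ^ 3) * (curv α c s * s⁻¹ ^ 3) := by
  set G : ℝ → ℝ := fun x => m x + 2 * x⁻¹ * curv α c x * (α * n x + β * b x)
      - 2 * m x * curv α c x ^ 2 * x⁻¹ ^ 2
      - 4 * curv α c x * x⁻¹ ^ 3 * ((α ^ 2 - β ^ 2) * n x + 2 * α * β * b x)
      - 4 * curv α c x ^ 3 * x⁻¹ ^ 3 * (α * n x + β * b x) with hG
  have hβ2 : β ^ 2 = 1 - α ^ 2 := by linarith
  obtain ⟨hα1, hβ1⟩ := abs_le_one_of_sq_add_sq hαβ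
  have hR1 : ∀ x, |α * n x + β * b x| ≤ 2 := h.abs_combination_le hα1 hβ1
  obtain ⟨i1, i2⟩ := abs_sq_coeff_le_one hαβ
  have hR2 : ∀ x, |(α ^ 2 - β ^ 2) * n x + 2 * α * β * b x| ≤ 2 := h.abs_combination_le i1 i2
  set G' : ℝ → ℝ := fun x => 8 * α * (α * curv α c x) * curv α c x * m x * x⁻¹ ^ 3
    + 12 * curv α c x * x⁻¹ ^ 4 * ((α ^ 2 - β ^ 2) * n x + 2 * α * β * b x)
    + 4 * (α * curv α c x) * curv α c x ^ 3 * m x * x⁻¹ ^ 3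
    + 4 * (α * curv α c x) * curv α c x ^ 2 * x⁻¹ ^ 2 * (α * n x + β * b x)
    + 12 * curv α c x ^ 3 * x⁻¹ ^ 4 * (α * n x + β * b x) with hG'
  have hderiv : ∀ x, s ≤ x → HasDerivAt G (G' x) x := fun x hx => by
    have hx0 : x ≠ 0 := by linarith
    have hm := h.deriv_m x
    have hn := h.deriv_n x
    have hb := h.deriv_b x
    have hk := hasDerivAt_curv α c x
    have hY := hasDerivAt_inv_real hx0
    have d1 := (hn.const_mul α).fun_add (hb.const_mul β)
    have d2 := (hn.const_mul (α ^ 2 - β ^ 2)).fun_add (hb.const_mul (2 * α * β))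
    refine ((((hm.fun_add (((hY.const_mul 2).fun_mul hk).fun_mul d1)).fun_sub
      (((hm.const_mul 2).fun_mul (hk.fun_pow 2)).fun_mul (hY.fun_pow 2))).fun_sub
      (((hk.const_mul 4).fun_mul (hY.fun_pow 3)).fun_mul d2)).fun_sub
      ((((hk.fun_pow 3).const_mul 4).fun_mul (hY.fun_pow 3)).fun_mul d1)).congr_deriv ?_
    simp only [hG']
    generalize curv α c x = k
    simp only [Nat.cast_ofNat, Nat.reduceSub, pow_one]
    field_simp
    ring_nf
    simp only [show β ^ 3 = β * β ^ 2 by ring, hβ2]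
    ring
  have hbound : ∀ x, s ≤ x → |G' x| ≤
      (24 + 32 * c + 72 * c ^ 2 + 16 * c ^ 3) * (curv α c x * x⁻¹ ^ 4) := fun x hx => by
    have hx0 : 0 < x := by linarith
    have hk0 := curv_pos hc α x
    have hkc := curv_le hc hα x
    have hY0 : 0 ≤ x⁻¹ := by positivity
    have hY1 : x⁻¹ ≤ 1 := inv_le_one_of_one_le₀ (by linarith)
    have hαk : α * curv α c x ≤ 4 * c * x⁻¹ ^ 2 := by
      rw [inv_pow, ← div_eq_mul_inv, le_div_iff₀ (by positivity)]
      exact mul_curv_mul_sq_le hc α x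
    have hm := (h.abs_le_one x).1
    have r1 := hR1 x
    have r2 := hR2 x
    simp only [hG']
    generalize α * n x + β * b x = R1 at *
    generalize (α ^ 2 - β ^ 2) * n x + 2 * α * β * b x = R2 at *
    generalize curv α c x = k at *
    generalize x⁻¹ = Y at *
    rw [abs_of_nonneg hα] at hα1
    have e0 : 0 ≤ α * k := by positivity
    generalize α * k = e at *
    have t1 : |8 * α * e * k * m x * Y ^ 3| ≤ 32 * c * (k * Y ^ 4) := by
      simp only [abs_mul, abs_pow, abs_of_nonneg hα, abs_of_nonneg e0, abs_of_pos hk0,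
        abs_of_nonneg hY0, Nat.abs_ofNat]
      calc 8 * α * e * k * |m x| * Y ^ 3 ≤ 8 * 1 * (4 * c * Y ^ 2) * k * 1 * Y ^ 3 := by gcongr
        _ = 32 * c * (k * Y ^ 4) * Y := by ring
        _ ≤ 32 * c * (k * Y ^ 4) * 1 := by gcongr
        _ = _ := by ring
    have t2 : |12 * k * Y ^ 4 * R2| ≤ 24 * (k * Y ^ 4) := by
      simp only [abs_mul, abs_pow, abs_of_pos hk0, abs_of_nonneg hY0, Nat.abs_ofNat]
      calc 12 * k * Y ^ 4 * |R2| ≤ 12 * k * Y ^ 4 * 2 := by gcongr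
        _ = _ := by ring
    have t3 : |4 * e * k ^ 3 * m x * Y ^ 3| ≤ 16 * c ^ 3 * (k * Y ^ 4) := by
      simp only [abs_mul, abs_pow, abs_of_nonneg e0, abs_of_pos hk0,
        abs_of_nonneg hY0, Nat.abs_ofNat]
      calc 4 * e * k ^ 3 * |m x| * Y ^ 3 ≤ 4 * (4 * c * Y ^ 2) * k ^ 3 * 1 * Y ^ 3 := by gcongr
        _ = 16 * c * (k * k ^ 2 * Y ^ 4) * Y := by ring
        _ ≤ 16 * c * (k * c ^ 2 * Y ^ 4) * 1 := by gcongr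
        _ = _ := by ring
    have t4 : |4 * e * k ^ 2 * Y ^ 2 * R1| ≤ 32 * c ^ 2 * (k * Y ^ 4) := by
      simp only [abs_mul, abs_pow, abs_of_nonneg e0, abs_of_pos hk0,
        abs_of_nonneg hY0, Nat.abs_ofNat]
      calc 4 * e * k ^ 2 * Y ^ 2 * |R1| ≤ 4 * (4 * c * Y ^ 2) * k ^ 2 * Y ^ 2 * 2 := by gcongr
        _ = 32 * c * (k * k * Y ^ 4) := by ring
        _ ≤ 32 * c * (k * c * Y ^ 4) := by gcongr
        _ = _ := by ring
    have t5 : |12 * k ^ 3 * Y ^ 4 * R1| ≤ 24 * c ^ 2 * (k * Y ^ 4) := by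
      simp only [abs_mul, abs_pow, abs_of_pos hk0, abs_of_nonneg hY0, Nat.abs_ofNat]
      calc 12 * k ^ 3 * Y ^ 4 * |R1| ≤ 12 * k ^ 3 * Y ^ 4 * 2 := by gcongr
        _ = 24 * (k ^ 2 * k * Y ^ 4) := by ring
        _ ≤ 24 * (c ^ 2 * k * Y ^ 4) := by gcongr
        _ = _ := by ring
    have t6 : 0 ≤ 16 * c ^ 2 * (k * Y ^ 4) := by positivity
    refine (abs_add_le _ _).trans ?_
    refine (add_le_add_left ((abs_add_le _ _).trans
      (add_le_add_left ((abs_add_le _ _).trans (add_le_add_left (abs_add_le _ _) _)) _)) _).trans ?_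
    linarith
  have hlim : Tendsto G atTop (𝓝 A) := by
    have h0 : Tendsto (fun x => G x - m x) atTop (𝓝 0) := by
      refine squeeze_zero_norm' (a := fun x : ℝ => (12 * c + 2 * c ^ 2 + 8 * c ^ 3) * x⁻¹) ?_
        (by simpa only [mul_zero] using
          (tendsto_inv_atTop_zero (𝕜 := ℝ)).const_mul (12 * c + 2 * c ^ 2 + 8 * c ^ 3))
      filter_upwards [eventually_ge_atTop 1] with x hx
      have hx0 : 0 < x := by linarith
      have hk0 := curv_pos hc α x
      have hkc := curv_le hc hα x
      have hY0 : 0 ≤ x⁻¹ := by positivity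
      have hY1 : x⁻¹ ≤ 1 := inv_le_one_of_one_le₀ (by linarith)
      have hm := (h.abs_le_one x).1
      have r1 := hR1 x
      have r2 := hR2 x
      simp only [hG, Real.norm_eq_abs]
      generalize α * n x + β * b x = R1 at *
      generalize (α ^ 2 - β ^ 2) * n x + 2 * α * β * b x = R2 at *
      generalize curv α c x = k at *
      generalize x⁻¹ = Y at *
      have hY2 : Y ^ 2 ≤ Y := by nlinarith
      have hY3 : Y ^ 3 ≤ Y := by nlinarith
      rw [show m x + 2 * Y * k * R1 - 2 * m x * k ^ 2 * Y ^ 2 - 4 * k * Y ^ 3 * R2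
        - 4 * k ^ 3 * Y ^ 3 * R1 - m x = 2 * Y * k * R1 - 2 * m x * k ^ 2 * Y ^ 2
        - 4 * k * Y ^ 3 * R2 - 4 * k ^ 3 * Y ^ 3 * R1 by ring]
      have t1 : |2 * Y * k * R1| ≤ 2 * Y * c * 2 := by
        simp only [abs_mul, abs_of_pos hk0, abs_of_nonneg hY0, Nat.abs_ofNat]
        gcongr
      have t2 : |2 * m x * k ^ 2 * Y ^ 2| ≤ 2 * 1 * c ^ 2 * Y := by
        simp only [abs_mul, abs_pow, abs_of_pos hk0, abs_of_nonneg hY0, Nat.abs_ofNat]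
        gcongr
      have t3 : |4 * k * Y ^ 3 * R2| ≤ 4 * c * Y * 2 := by
        simp only [abs_mul, abs_pow, abs_of_pos hk0, abs_of_nonneg hY0, Nat.abs_ofNat]
        gcongr
      have t4 : |4 * k ^ 3 * Y ^ 3 * R1| ≤ 4 * c ^ 3 * Y * 2 := by
        simp only [abs_mul, abs_pow, abs_of_pos hk0, abs_of_nonneg hY0, Nat.abs_ofNat]
        gcongr
      rw [abs_le] at t1 t2 t3 t4 ⊢
      constructor <;> linarith
    simpa using h0.add hA
  refine norm_sub_le_of_deriv_le_of_tendsto (F := G) (F' := G') (s := s)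
    (g := fun x => (24 + 32 * c + 72 * c ^ 2 + 16 * c ^ 3) * (curv α c x * x⁻¹ ^ 3))
    hderiv (fun x hx => ((hasDerivAt_curv α c x).fun_mul
      ((hasDerivAt_inv_real (by linarith)).fun_pow 3)).const_mul _) (fun x hx => ?_)
      (fun x hx => ?_) hlim
  · have hk0 := curv_pos hc α x
    have hx0 : 0 < x := by linarith
    refine (hbound x hx).trans ?_
    rw [← mul_neg]
    gcongr
    have : 0 ≤ α * x / 2 * curv α c x * x⁻¹ ^ 3 := by positivity
    have : 0 ≤ curv α c x * x⁻¹ ^ 4 := by positivity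
    simp only [Nat.cast_ofNat, Nat.add_one_sub_one]
    linarith
  · have := curv_pos hc α x
    have hx0 : 0 < x := by linarith
    positivity
lemma hasDerivAt_phase {α β c a x : ℝ} (hx : 4 * Real.sqrt (8 + c ^ 2) ≤ x) :
    HasDerivAt (phase α β c a)
      (β * (x / 2 * Real.sqrt (1 + 4 * curv α c x ^ 2 * x⁻¹ ^ 2))) x := by
  have h0 : 0 < 4 * Real.sqrt (8 + c ^ 2) := by positivity
  have hx0 : 0 < x := h0.trans_le hx
  set f : ℝ → ℝ := fun σ => Real.sqrt (1 + c ^ 2 * Real.exp (-2 * α * σ) / σ) with hf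
  have hcont : ContinuousOn f (Set.Ioi 0) := by
    intro σ hσ
    have : σ ≠ 0 := (Set.mem_Ioi.1 hσ).ne'
    refine ContinuousAt.continuousWithinAt ?_
    fun_prop (disch := assumption)
  have hσ : 0 < x ^ 2 / 4 := by positivity
  have hint : IntervalIntegrable f volume ((4 * Real.sqrt (8 + c ^ 2)) ^ 2 / 4) (x ^ 2 / 4) := by
    refine (hcont.mono fun y hy => ?_).intervalIntegrable
    exact (lt_min (by positivity) hσ).trans_le hy.1
  have h1 := intervalIntegral.integral_hasDerivAt_right hint
    (hcont.stronglyMeasurableAtFilter isOpen_Ioi _ hσ) (hcont.continuousAt (Ioi_mem_nhds hσ))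
  have h2 : HasDerivAt (fun y : ℝ => y ^ 2 / 4) (x / 2) x := by
    refine ((hasDerivAt_pow 2 x).div_const 4).congr_deriv ?_
    push_cast; ring
  have h3 := (((h1.comp x h2).const_mul β).const_add a)
  refine h3.congr_deriv ?_
  have : f (x ^ 2 / 4) = Real.sqrt (1 + 4 * curv α c x ^ 2 * x⁻¹ ^ 2) := by
    simp only [hf, curv]
    congr 2
    rw [mul_pow, ← Real.exp_nat_mul]
    rw [show -2 * α * (x ^ 2 / 4) = ((2 : ℕ) : ℝ) * (-α * x ^ 2 / 4) by push_cast; ring]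
    field_simp
  rw [this]; ring

lemma abs_mul_sqrt_sub_le {x k : ℝ} (hx : 0 < x) :
    |x / 2 * Real.sqrt (1 + 4 * k ^ 2 * x⁻¹ ^ 2) - x / 2 - k ^ 2 * x⁻¹| ≤ k ^ 4 * x⁻¹ ^ 3 := by
  have hY : 0 < x⁻¹ := by positivity
  have hxY : x * x⁻¹ = 1 := mul_inv_cancel₀ hx.ne'
  generalize x⁻¹ = Y at *
  set t := k ^ 2 * Y ^ 2 with ht
  have ht0 : 0 ≤ t := by positivity
  rw [show 1 + 4 * k ^ 2 * Y ^ 2 = 1 + 4 * t by rw [ht]; ring]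
  have hu : Real.sqrt (1 + 4 * t) ≤ 1 + 2 * t := by
    rw [Real.sqrt_le_left (by positivity)]; nlinarith
  have hl : 1 + 2 * t - 2 * t ^ 2 ≤ Real.sqrt (1 + 4 * t) := by
    by_cases h1 : 1 + 2 * t - 2 * t ^ 2 ≤ 0
    · exact h1.trans (Real.sqrt_nonneg _)
    · refine Real.le_sqrt_of_sq_le ?_
      push Not at h1
      have : t ≤ 2 := by nlinarith
      nlinarith [mul_nonneg (pow_nonneg ht0 3) (sub_nonneg.2 this)]
  have e1 : x * t = k ^ 2 * Y := by rw [ht]; linear_combination k ^ 2 * Y * hxY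
  have e2 : x * t ^ 2 = k ^ 4 * Y ^ 3 := by rw [ht]; linear_combination k ^ 4 * Y ^ 3 * hxY
  rw [abs_le]
  constructor <;> nlinarith

/-- The complex normal `n + i b`. -/
def cnormal (n b : ℝ → ℝ) (x : ℝ) : ℂ := n x + b x * Complex.I

/-- The difference between `n + i b` and its slowly modulated part, up to `O(1/x³)`. -/
def modCorrection (M : ℂ) (k m Y : ℝ) (wb : ℂ) : ℂ :=
  - M ^ 2 * k ^ 2 * Y ^ 2 * wb + 2 * M ^ 2 * Y ^ 3 * (2 - M * k ^ 2) * m * k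

/-- The modulated complex normal. -/
def modNormal (α β c : ℝ) (m n b : ℝ → ℝ) (x : ℝ) : ℂ :=
  cnormal n b x - 2 * (α + β * Complex.I) * curv α c x * m x * (x⁻¹ : ℝ)
    + modCorrection (α + β * Complex.I) (curv α c x) (m x) x⁻¹ (cnormal n (-b) x)

/-- `x³` times the error term in the modulation equation of `modNormal`. -/
def modError (M J e k m n Y w wb : ℂ) : ℂ :=
  -e * k * w + 2 * M * e * k ^ 2 * m * Y + 2 * M ^ 2 * k ^ 2 * wb
    + -6 * M ^ 2 * Y * (2 - M * k ^ 2) * m * k + 2 * M ^ 2 * (2 - M * k ^ 2) * k ^ 2 * n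
    + 2 * M ^ 3 * Y * e * k ^ 2 * m + -J * M ^ 2 * k ^ 4 * wb
    + 2 * J * M ^ 2 * Y * k ^ 2 * (2 - M * k ^ 2) * m * k

lemma norm_two_sub_le {M k : ℂ} {c : ℝ} (hM : ‖M‖ = 1) (hk : ‖k‖ ≤ c) :
    ‖2 - M * k ^ 2‖ ≤ 2 + c ^ 2 := by
  refine (norm_sub_le _ _).trans ?_
  simp only [norm_mul, norm_pow, hM, one_mul, Complex.norm_ofNat]
  gcongr

/-- A bound of `modError`. -/
def modErrorBound (c : ℝ) : ℝ :=
  4 * c * c * 1 + 2 * 1 * (4 * c) * c ^ 2 * 1 * 1 + 2 * 1 ^ 2 * c ^ 2 * 1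
    + 6 * 1 ^ 2 * 1 * (2 + c ^ 2) * 1 * c + 2 * 1 ^ 2 * (2 + c ^ 2) * c ^ 2 * 1
    + 2 * 1 ^ 3 * 1 * (4 * c) * c ^ 2 * 1 + 1 * 1 ^ 2 * c ^ 4 * 1
    + 2 * 1 * 1 ^ 2 * 1 * c ^ 2 * (2 + c ^ 2) * 1 * c

lemma norm_modError_le {M J e k m n Y w wb : ℂ} {c : ℝ} (hM : ‖M‖ = 1) (hJ : ‖J‖ ≤ 1)
    (he : ‖e‖ ≤ 4 * c) (hk : ‖k‖ ≤ c) (hm : ‖m‖ ≤ 1) (hn : ‖n‖ ≤ 1) (hY : ‖Y‖ ≤ 1)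
    (hw : ‖w‖ ≤ 1) (hwb : ‖wb‖ ≤ 1) :
    ‖modError M J e k m n Y w wb‖ ≤ modErrorBound c := by
  have hT := norm_two_sub_le hM hk
  have hc : 0 ≤ c := (norm_nonneg k).trans hk
  have hM1 := hM.le
  unfold modError modErrorBound
  refine norm_add_le_of_le (norm_add_le_of_le (norm_add_le_of_le (norm_add_le_of_le
    (norm_add_le_of_le (norm_add_le_of_le (norm_add_le_of_le ?_ ?_) ?_) ?_) ?_) ?_) ?_) ?_ <;>
  · simp only [norm_mul, norm_neg, norm_pow, Complex.norm_ofNat]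
    gcongr

lemma norm_modCorrection_le {M wb : ℂ} {k m Y c : ℝ} (hM : ‖M‖ = 1) (hk : |k| ≤ c)
    (hm : |m| ≤ 1) (hY0 : 0 ≤ Y) (hY : Y ≤ 1) (hwb : ‖wb‖ ≤ 1) :
    ‖modCorrection M k m Y wb‖ ≤ (c ^ 2 + 2 * (2 + c ^ 2) * c) * Y ^ 2 := by
  have hk' : ‖(k : ℂ)‖ ≤ c := by simpa using hk
  have hT := norm_two_sub_le hM hk'
  have hc : 0 ≤ c := (abs_nonneg k).trans hk
  have hY3 : Y ^ 3 ≤ Y ^ 2 := pow_le_pow_of_le_one hY0 hY (by norm_num)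
  unfold modCorrection
  refine (norm_add_le _ _).trans ?_
  simp only [norm_mul, norm_neg, norm_pow, hM, one_pow, one_mul, mul_one, Complex.norm_ofNat,
    Complex.norm_real, Real.norm_eq_abs, abs_of_nonneg hY0]
  calc _ ≤ c ^ 2 * Y ^ 2 * 1 + 2 * Y ^ 2 * (2 + c ^ 2) * 1 * c := by gcongr
    _ = _ := by ring

lemma norm_unit {α β : ℝ} (h : α ^ 2 + β ^ 2 = 1) : ‖(α + β * Complex.I : ℂ)‖ = 1 := by
  rw [Complex.norm_add_mul_I, h, Real.sqrt_one]

lemma IsCoordSF.norm_cnormal_eq_sqrt {α β c : ℝ} {m n b : ℝ → ℝ} (h : IsCoordSF α β c m n b)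
    (x : ℝ) :
    ‖cnormal n b x‖ = Real.sqrt (1 - m x ^ 2) := by
  unfold cnormal
  rw [Complex.norm_add_mul_I, ← h.sq_add x]
  congr 1; ring

lemma IsCoordSF.norm_cnormal_le {α β c : ℝ} {m n b : ℝ → ℝ} (h : IsCoordSF α β c m n b) (x : ℝ) :
    ‖cnormal n b x‖ ≤ 1 ∧ ‖cnormal n (-b) x‖ ≤ 1 := by
  have h1 := h.sq_add x
  unfold cnormal
  rw [Complex.norm_add_mul_I, Complex.norm_add_mul_I, Pi.neg_apply]
  constructor <;> refine Real.sqrt_le_one.2 ?_ <;> nlinarith [sq_nonneg (m x)]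

lemma IsCoordSF.hasDerivAt_modNormal {α β c : ℝ} (hαβ : α ^ 2 + β ^ 2 = 1)
    {m n b : ℝ → ℝ} (h : IsCoordSF α β c m n b) {x : ℝ} (hx : x ≠ 0) :
    HasDerivAt (modNormal α β c m n b)
      (-(β * Complex.I) * ((x / 2 + curv α c x ^ 2 * x⁻¹ : ℝ) : ℂ) * modNormal α β c m n b x
        + (x⁻¹ : ℝ) ^ 3 * modError (α + β * Complex.I) (β * Complex.I)
          (α * curv α c x * x ^ 2 : ℝ) (curv α c x) (m x) (n x) (x⁻¹ : ℝ)
          (cnormal n b x) (cnormal n (-b) x)) x := by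
  have hm := (h.deriv_m x).ofReal_comp
  have hn := (h.deriv_n x).ofReal_comp
  have hb := (h.deriv_b x).ofReal_comp
  have hk := (hasDerivAt_curv α c x).ofReal_comp
  have hY := (hasDerivAt_inv_real hx).ofReal_comp
  have hw : HasDerivAt (cnormal n b)
      (-(curv α c x * m x) - (β * Complex.I) * (x / 2) * cnormal n b x) x := by
    refine (hn.fun_add (hb.mul_const Complex.I)).congr_deriv ?_
    unfold cnormal
    push_cast
    linear_combination (β * x / 2 * b x : ℂ) * Complex.I_sq
  have hwb : HasDerivAt (cnormal n (-b))
      (-(curv α c x * m x) + (β * Complex.I) * (x / 2) * cnormal n (-b) x) x := by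
    have := hn.fun_sub (hb.mul_const Complex.I)
    refine (this.congr_of_eventuallyEq (Eventually.of_forall fun y => ?_)).congr_deriv ?_
    · simp [cnormal, sub_eq_add_neg]
    · simp only [cnormal, Pi.neg_apply]
      push_cast
      linear_combination (β * x / 2 * b x : ℂ) * Complex.I_sq
  have hnw : (n x : ℂ) = (cnormal n b x + cnormal n (-b) x) / 2 := by
    simp only [cnormal, Pi.neg_apply]; push_cast; ring
  have hMne : (α + β * Complex.I : ℂ) ≠ 0 := by
    rw [← norm_ne_zero_iff, norm_unit hαβ]; norm_num
  have hc2 : (α : ℂ) ^ 2 + β ^ 2 = 1 := by exact_mod_cast hαβ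
  have hMinv : (α + β * Complex.I : ℂ)⁻¹ = α - β * Complex.I := by
    refine inv_eq_of_mul_eq_one_right ?_
    linear_combination hc2 - (β : ℂ) ^ 2 * Complex.I_sq
  generalize hM : (α + β * Complex.I : ℂ) = M at *
  have hα : (α : ℂ) = (M + M⁻¹) / 2 := by rw [hMinv, ← hM]; ring
  have hJ : (β * Complex.I : ℂ) = (M - M⁻¹) / 2 := by rw [hMinv, ← hM]; ring
  have key := ((hw.fun_sub (((hk.const_mul (2 * M)).fun_mul hm).fun_mul hY)).fun_add
    (((((hk.fun_pow 2).const_mul (-M ^ 2)).fun_mul (hY.fun_pow 2)).fun_mul hwb).fun_add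
      (((((hY.fun_pow 3).const_mul (2 * M ^ 2)).fun_mul
        (((hk.fun_pow 2).const_mul M).const_sub 2)).fun_mul hm).fun_mul hk)))
  have hfun : modNormal α β c m n b = fun x =>
      cnormal n b x - 2 * M * curv α c x * m x * (x⁻¹ : ℝ)
      + (-M ^ 2 * curv α c x ^ 2 * (x⁻¹ : ℝ) ^ 2 * cnormal n (-b) x
        + 2 * M ^ 2 * (x⁻¹ : ℝ) ^ 3 * (2 - M * curv α c x ^ 2) * m x * curv α c x) := by
    funext y; simp only [modNormal, modCorrection, hM]
  rw [hfun]
  refine key.congr_deriv ?_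
  have hxc : (x : ℂ) ≠ 0 := by exact_mod_cast hx
  simp only [modError]
  push_cast
  rw [hJ, hα, hnw]
  generalize cnormal n b x = w
  generalize cnormal n (-b) x = wb
  generalize (curv α c x : ℂ) = k
  simp only [pow_one]
  field_simp
  ring
/-- `modNormal` is a constant times `e^{-iΦ}` up to `O(1/x²)`. -/
lemma exists_amplitude {c : ℝ} (hc : 0 < c) :
    ∃ D : ℝ, 0 ≤ D ∧ ∀ α β : ℝ, 0 ≤ α → α ^ 2 + β ^ 2 = 1 → ∀ m n b : ℝ → ℝ,
      IsCoordSF α β c m n b → ∀ A : ℝ, Tendsto m atTop (𝓝 A) →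
      ∃ Z : ℂ, ‖Z‖ = Real.sqrt (1 - A ^ 2) ∧ ∀ s, 4 * Real.sqrt (8 + c ^ 2) ≤ s →
        ‖cnormal n b s - 2 * (α + β * Complex.I) * curv α c s * m s * (s⁻¹ : ℝ)
          - Complex.exp ((-phase α β c 0 s : ℝ) * Complex.I) * Z‖ ≤ D * s⁻¹ ^ 2 := by
  set D₁ := c ^ 2 + 2 * (2 + c ^ 2) * c with hD₁
  set D₂ := c ^ 4 * (1 + 2 * c + D₁) + modErrorBound c with hD₂
  have hD₁0 : 0 ≤ D₁ := by positivity
  have hD₂0 : 0 ≤ D₂ := by rw [hD₂]; unfold modErrorBound; positivity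
  refine ⟨D₂ + D₁, by positivity, fun α β hα hαβ m n b h A hA => ?_⟩
  have hs₀ : 1 ≤ 4 * Real.sqrt (8 + c ^ 2) := by
    have : 1 ≤ Real.sqrt (8 + c ^ 2) := Real.one_le_sqrt.2 (by nlinarith)
    linarith
  have hM := norm_unit hαβ
  have hβ1 := (abs_le_one_of_sq_add_sq hαβ).2
  have hcorr : ∀ x, 1 ≤ x → ‖modCorrection (α + β * Complex.I) (curv α c x) (m x) x⁻¹
      (cnormal n (-b) x)‖ ≤ D₁ * x⁻¹ ^ 2 := fun x hx =>
    norm_modCorrection_le hM (by rw [abs_of_pos (curv_pos hc α x)]; exact curv_le hc hα x)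
      (h.abs_le_one x).1 (by positivity) (inv_le_one_of_one_le₀ hx) (h.norm_cnormal_le x).2
  have hmain : ∀ x, 1 ≤ x → ‖2 * (α + β * Complex.I) * curv α c x * m x * (x⁻¹ : ℝ)‖
      ≤ 2 * c * x⁻¹ := fun x hx => by
    have hY0 : 0 ≤ x⁻¹ := by positivity
    have hk0 := curv_pos hc α x
    have hkc := curv_le hc hα x
    have hm := (h.abs_le_one x).1
    simp only [norm_mul, hM, Complex.norm_real, Real.norm_eq_abs, abs_of_nonneg hY0,
      abs_of_pos hk0, Complex.norm_ofNat]
    calc 2 * 1 * curv α c x * |m x| * x⁻¹ ≤ 2 * 1 * c * 1 * x⁻¹ := by gcongr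
      _ = _ := by ring
  have hdiff : ∀ x, 1 ≤ x → ‖modNormal α β c m n b x - cnormal n b x‖ ≤ (2 * c + D₁) * x⁻¹ :=
    fun x hx => by
    have hY0 : 0 ≤ x⁻¹ := by positivity
    have hY1 : x⁻¹ ≤ 1 := inv_le_one_of_one_le₀ hx
    have h1 := hcorr x hx
    have h2 := hmain x hx
    unfold modNormal
    rw [sub_add, sub_sub_cancel_left, norm_neg]
    refine (norm_sub_le _ _).trans ?_
    have : D₁ * x⁻¹ ^ 2 ≤ D₁ * x⁻¹ := by gcongr; nlinarith
    linarith
  have hW : ∀ x, 1 ≤ x → ‖modNormal α β c m n b x‖ ≤ 1 + 2 * c + D₁ := fun x hx => by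
    have hY1 : x⁻¹ ≤ 1 := inv_le_one_of_one_le₀ hx
    have h1 := hdiff x hx
    have h2 := (h.norm_cnormal_le x).1
    have h3 : (2 * c + D₁) * x⁻¹ ≤ (2 * c + D₁) * 1 := by gcongr
    have h4 := norm_le_norm_add_norm_sub' (modNormal α β c m n b x) (cnormal n b x)
    linarith
  set Φ := phase α β c 0
  set V : ℝ → ℂ := fun x => Complex.exp (Φ x * Complex.I) * modNormal α β c m n b x with hV
  set V' : ℝ → ℂ := fun x => Complex.exp (Φ x * Complex.I) *
    ((β * (x / 2 * Real.sqrt (1 + 4 * curv α c x ^ 2 * x⁻¹ ^ 2) - x / 2 - curv α c x ^ 2 * x⁻¹)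
        : ℝ) * Complex.I * modNormal α β c m n b x
      + (x⁻¹ : ℝ) ^ 3 * modError (α + β * Complex.I) (β * Complex.I)
          (α * curv α c x * x ^ 2 : ℝ) (curv α c x) (m x) (n x) (x⁻¹ : ℝ)
          (cnormal n b x) (cnormal n (-b) x)) with hV'
  have hderiv : ∀ x, 4 * Real.sqrt (8 + c ^ 2) ≤ x → HasDerivAt V (V' x) x := fun x hx => by
    have hx0 : x ≠ 0 := by linarith
    have h1 := (((hasDerivAt_phase (α := α) (β := β) (a := 0) hx).ofReal_comp).mul_const
      Complex.I).cexp
    refine (h1.fun_mul (h.hasDerivAt_modNormal hαβ hx0)).congr_deriv ?_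
    simp only [hV']
    push_cast
    ring
  have hbound : ∀ x, 4 * Real.sqrt (8 + c ^ 2) ≤ x → ‖V' x‖ ≤ D₂ * x⁻¹ ^ 3 := fun x hx => by
    have hx1 : 1 ≤ x := hs₀.trans hx
    have hx0 : 0 < x := by linarith
    have hY0 : 0 ≤ x⁻¹ := by positivity
    have hY1 : x⁻¹ ≤ 1 := inv_le_one_of_one_le₀ hx1
    have hk0 := curv_pos hc α x
    have hkc := curv_le hc hα x
    obtain ⟨hm, hn, -⟩ := h.abs_le_one x
    obtain ⟨hw, hwb⟩ := h.norm_cnormal_le x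
    have hE := norm_modError_le (c := c) (M := α + β * Complex.I) (J := β * Complex.I)
      (e := (α * curv α c x * x ^ 2 : ℝ)) (k := curv α c x) (m := m x) (n := n x)
      (Y := (x⁻¹ : ℝ)) (w := cnormal n b x) (wb := cnormal n (-b) x) hM (by simpa using hβ1)
      (by rw [Complex.norm_real, Real.norm_of_nonneg (by positivity)]
          exact mul_curv_mul_sq_le hc α x)
      (by rw [Complex.norm_real, Real.norm_of_nonneg hk0.le]; exact hkc)
      (by simpa using hm) (by simpa using hn)
      (by rw [Complex.norm_real, Real.norm_of_nonneg hY0]; exact hY1) hw hwb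
    have hS := abs_mul_sqrt_sub_le (k := curv α c x) hx0
    simp only [hV']
    rw [norm_mul, Complex.norm_exp_ofReal_mul_I, one_mul, hD₂, add_mul]
    refine norm_add_le_of_le ?_ ?_
    · rw [norm_mul, norm_mul, Complex.norm_I, mul_one, Complex.norm_real, Real.norm_eq_abs, abs_mul]
      calc _ ≤ 1 * (c ^ 4 * x⁻¹ ^ 3) * (1 + 2 * c + D₁) := by
            gcongr
            · exact hS.trans (by gcongr)
            · exact hW x hx1
        _ = _ := by ring
    · rw [norm_mul, norm_pow, Complex.norm_real, Real.norm_of_nonneg hY0, mul_comm]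
      gcongr
  obtain ⟨Z, hZlim, hZ⟩ := exists_norm_sub_le_of_deriv_le (g := fun x => D₂ * x⁻¹ ^ 2)
    (s₀ := 4 * Real.sqrt (8 + c ^ 2)) hderiv
    (fun x hx => ((hasDerivAt_inv_real (by linarith)).fun_pow 2).const_mul D₂)
    (fun x hx => (hbound x hx).trans (by
      have hx0 : 0 < x := by linarith
      have : 0 ≤ D₂ * x⁻¹ ^ 3 := by positivity
      push_cast
      simp only [pow_one]
      linarith)) (fun x _ => by positivity)
    (by simpa using ((tendsto_inv_atTop_zero (𝕜 := ℝ)).pow 2).const_mul D₂)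
  have hVn : ∀ x, ‖V x‖ = ‖modNormal α β c m n b x‖ := fun x => by
    simp only [hV, norm_mul, Complex.norm_exp_ofReal_mul_I, one_mul]
  refine ⟨Z, ?_, fun s hs => ?_⟩
  · have l1 : Tendsto (fun x => ‖V x‖) atTop (𝓝 ‖Z‖) := hZlim.norm
    have l2 : Tendsto (fun x => ‖V x‖ - ‖cnormal n b x‖) atTop (𝓝 0) := by
      refine squeeze_zero_norm' (a := fun x : ℝ => (2 * c + D₁) * x⁻¹) ?_
        (by simpa only [mul_zero] using
          (tendsto_inv_atTop_zero (𝕜 := ℝ)).const_mul (2 * c + D₁))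
      filter_upwards [eventually_ge_atTop 1] with x hx
      rw [hVn]
      exact (abs_norm_sub_norm_le _ _).trans (hdiff x hx)
    have l3 : Tendsto (fun x => ‖cnormal n b x‖) atTop (𝓝 (Real.sqrt (1 - A ^ 2))) := by
      simp only [h.norm_cnormal_eq_sqrt]
      exact ((hA.pow 2).const_sub 1).sqrt
    exact tendsto_nhds_unique (by simpa using l1) (by simpa using l2.add l3)
  · have h1 := hZ s hs
    have h2 := hcorr s (hs₀.trans hs)
    have h3 : cnormal n b s - 2 * (α + β * Complex.I) * curv α c s * m s * (s⁻¹ : ℝ)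
          - Complex.exp ((-Φ s : ℝ) * Complex.I) * Z
        = Complex.exp ((-Φ s : ℝ) * Complex.I) * (V s - Z)
          - modCorrection (α + β * Complex.I) (curv α c s) (m s) s⁻¹ (cnormal n (-b) s) := by
      have : Complex.exp ((-Φ s : ℝ) * Complex.I) * Complex.exp (Φ s * Complex.I) = 1 := by
        rw [← Complex.exp_add]; simp
      simp only [hV, mul_sub, ← mul_assoc, this, one_mul]
      unfold modNormal
      ring
    rw [h3, add_mul]
    refine norm_sub_le_of_le ?_ h2
    rwa [norm_mul, Complex.norm_exp_ofReal_mul_I, one_mul]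
lemma phase_eq_add (α β c a s : ℝ) : phase α β c a s = a + phase α β c 0 s := by
  unfold phase; ring

/-- The amplitude `Z` produces the oscillating term with phase shift `π/2 - arg Z`. -/
lemma exists_phase_shift (α β : ℝ) (Z : ℂ) :
    ∃ a ∈ Set.Ico (0 : ℝ) (2 * π), ∀ t : ℝ,
      ((α - β * Complex.I) * (Complex.exp ((-t : ℝ) * Complex.I) * Z)).re
        = ‖Z‖ * (α * Real.sin (a + t) + β * Real.cos (a + t)) := by
  set a := toIcoMod Real.two_pi_pos 0 (π / 2 - Z.arg) with ha
  refine ⟨a, toIcoMod_mem_Ico' _ _, fun t => ?_⟩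
  have ha' : a + t = π / 2 - (Z.arg - t)
      - (toIcoDiv Real.two_pi_pos 0 (π / 2 - Z.arg) : ℤ) * (2 * π) := by
    rw [ha, ← self_sub_toIcoDiv_zsmul, zsmul_eq_mul]; ring
  have hZ : Complex.exp ((-t : ℝ) * Complex.I) * Z
      = ‖Z‖ * (Real.cos (Z.arg - t) + Real.sin (Z.arg - t) * Complex.I) := by
    conv_lhs => rw [← Complex.norm_mul_exp_arg_mul_I Z]
    rw [Complex.ofReal_cos, Complex.ofReal_sin, ← Complex.exp_mul_I, mul_left_comm,
      ← Complex.exp_add]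
    push_cast
    ring_nf
  rw [ha', Real.sin_sub_int_mul_two_pi, Real.cos_sub_int_mul_two_pi, Real.sin_pi_div_two_sub,
    Real.cos_pi_div_two_sub, hZ]
  simp only [Complex.mul_re, Complex.mul_im, Complex.sub_re, Complex.sub_im, Complex.add_re,
    Complex.add_im, Complex.ofReal_re, Complex.ofReal_im, Complex.I_re, Complex.I_im]
  ring

lemma coord_asymptotics {c : ℝ} (hc : 0 < c) :
    ∃ C : ℝ, 0 < C ∧ ∀ α β : ℝ, 0 ≤ α → α ^ 2 + β ^ 2 = 1 → ∀ m n b : ℝ → ℝ,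
      IsCoordSF α β c m n b → ∀ A : ℝ, Tendsto m atTop (𝓝 A) →
      ∃ a ∈ Set.Ico (0 : ℝ) (2 * π), ∀ s, 4 * Real.sqrt (8 + c ^ 2) ≤ s →
        |m s - A + 2 * s⁻¹ * curv α c s * (Real.sqrt (1 - A ^ 2) *
            (α * Real.sin (phase α β c a s) + β * Real.cos (phase α β c a s)))
          + 2 * curv α c s ^ 2 * s⁻¹ ^ 2 * A| ≤ C * (curv α c s * s⁻¹ ^ 3) := by
  obtain ⟨D, hD0, hD⟩ := exists_amplitude hc
  set G₀ := 24 + 32 * c + 72 * c ^ 2 + 16 * c ^ 3 with hG₀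
  have hG₀0 : 0 ≤ G₀ := by positivity
  set E := G₀ + 4 + 2 * c + 8 + 8 * c ^ 2 with hE
  have hE0 : 0 ≤ E := by positivity
  refine ⟨G₀ + 2 * D + 2 * c ^ 2 * E + 8 + 8 * c ^ 2, by positivity,
    fun α β hα hαβ m n b h A hA => ?_⟩
  obtain ⟨Z, hZ, hZs⟩ := hD α β hα hαβ m n b h A hA
  obtain ⟨a, ha, hphase⟩ := exists_phase_shift α β Z
  refine ⟨a, ha, fun s hs => ?_⟩
  have hs1 : 1 ≤ s := by
    have : 1 ≤ Real.sqrt (8 + c ^ 2) := Real.one_le_sqrt.2 (by nlinarith)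
    linarith
  have hY0 : 0 ≤ s⁻¹ := by positivity
  have hY1 : s⁻¹ ≤ 1 := inv_le_one_of_one_le₀ hs1
  have hk0 := curv_pos hc α s
  have hkc := curv_le hc hα s
  have hm := (h.abs_le_one s).1
  obtain ⟨hα1, hβ1⟩ := abs_le_one_of_sq_add_sq hαβ
  obtain ⟨i1, i2⟩ := abs_sq_coeff_le_one hαβ
  have r1 := h.abs_combination_le hα1 hβ1 s
  have r2 := h.abs_combination_le i1 i2 s
  have hG := h.abs_sub_le hc hα hαβ hA hs1
  have hp := hphase (phase α β c 0 s)
  rw [← phase_eq_add, hZ] at hp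
  rw [← hp]
  set P := ((α - β * Complex.I) *
    (Complex.exp ((-phase α β c 0 s : ℝ) * Complex.I) * Z)).re with hP
  have hr : |α * n s + β * b s - 2 * curv α c s * m s * s⁻¹ - P| ≤ D * s⁻¹ ^ 2 := by
    refine le_trans ?_ (hZs s hs)
    have hN : ‖(α - β * Complex.I : ℂ)‖ = 1 := by
      have := norm_unit (α := α) (β := -β) (by rw [neg_sq]; exact hαβ)
      rw [← this]; push_cast; ring_nf
    rw [← one_mul ‖_‖, ← hN, ← norm_mul]
    refine le_trans (le_of_eq ?_) (Complex.abs_re_le_norm _)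
    congr 1
    rw [mul_sub, Complex.sub_re, ← hP]
    congr 1
    simp only [cnormal, Complex.mul_re, Complex.mul_im, Complex.sub_re, Complex.sub_im,
      Complex.add_re, Complex.add_im, Complex.ofReal_re, Complex.ofReal_im, Complex.I_re,
      Complex.I_im, Complex.re_ofNat, Complex.im_ofNat]
    linear_combination (2 * curv α c s * m s * s⁻¹) * hαβ
  rw [← hG₀] at hG
  generalize α * n s + β * b s = R1 at *
  generalize (α ^ 2 - β ^ 2) * n s + 2 * α * β * b s = R2 at *
  clear_value P E G₀
  generalize curv α c s = k at *
  generalize s⁻¹ = Y at *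
  generalize m s = μ at *
  have hY2 : Y ^ 2 ≤ Y := by nlinarith
  have hY3 : Y ^ 3 ≤ Y := by nlinarith
  have t1 : |4 * k * Y ^ 3 * R2| ≤ 8 * (k * Y ^ 3) := by
    simp only [abs_mul, abs_pow, abs_of_pos hk0, abs_of_nonneg hY0, Nat.abs_ofNat]
    calc 4 * k * Y ^ 3 * |R2| ≤ 4 * k * Y ^ 3 * 2 := by gcongr
      _ = _ := by ring
  have t2 : |4 * k ^ 3 * Y ^ 3 * R1| ≤ 8 * c ^ 2 * (k * Y ^ 3) := by
    simp only [abs_mul, abs_pow, abs_of_pos hk0, abs_of_nonneg hY0, Nat.abs_ofNat]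
    calc 4 * k ^ 3 * Y ^ 3 * |R1| ≤ 4 * k ^ 3 * Y ^ 3 * 2 := by gcongr
      _ = 8 * k ^ 2 * (k * Y ^ 3) := by ring
      _ ≤ _ := by gcongr
  have t3 : |2 * Y * k * R1| ≤ 4 * (k * Y) := by
    simp only [abs_mul, abs_of_pos hk0, abs_of_nonneg hY0, Nat.abs_ofNat]
    calc 2 * Y * k * |R1| ≤ 2 * Y * k * 2 := by gcongr
      _ = _ := by ring
  have t4 : |2 * μ * k ^ 2 * Y ^ 2| ≤ 2 * c * (k * Y) := by
    simp only [abs_mul, abs_pow, abs_of_pos hk0, abs_of_nonneg hY0, Nat.abs_ofNat]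
    calc 2 * |μ| * k ^ 2 * Y ^ 2 ≤ 2 * 1 * k ^ 2 * Y := by gcongr
      _ = 2 * k * (k * Y) := by ring
      _ ≤ _ := by gcongr
  have hkY : k * Y ^ 3 ≤ k * Y := by gcongr
  have hdist : |μ - A| ≤ E * (k * Y) := by
    have e1 : G₀ * (k * Y ^ 3) ≤ G₀ * (k * Y) := by gcongr
    have e2 : 8 * c ^ 2 * (k * Y ^ 3) ≤ 8 * c ^ 2 * (k * Y) := by gcongr
    rw [abs_le] at hG t1 t2 t3 t4 ⊢
    rw [hE]
    constructor <;> linarith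
  have t5 : |2 * k ^ 2 * Y ^ 2 * (μ - A)| ≤ 2 * c ^ 2 * E * (k * Y ^ 3) := by
    rw [abs_mul, abs_of_nonneg (by positivity : 0 ≤ 2 * k ^ 2 * Y ^ 2)]
    calc _ ≤ 2 * k ^ 2 * Y ^ 2 * (E * (k * Y)) := by gcongr
      _ = 2 * k ^ 2 * E * (k * Y ^ 3) := by ring
      _ ≤ _ := by gcongr
  have t6 : |2 * Y * k * (R1 - 2 * k * μ * Y - P)| ≤ 2 * D * (k * Y ^ 3) := by
    rw [abs_mul, abs_of_nonneg (by positivity : 0 ≤ 2 * Y * k)]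
    calc _ ≤ 2 * Y * k * (D * Y ^ 2) := by gcongr
      _ = _ := by ring
  rw [abs_le] at hG t1 t2 t5 t6 ⊢
  constructor <;> linarith

lemma IsSF.coord {α β c : ℝ} {m n b : ℝ → E3} (h : IsSF α β c m n b) (j : Fin 3) :
    IsCoordSF α β c (fun x => m x j) (fun x => n x j) (fun x => b x j) := by
  obtain ⟨hm, hn, hb, m0, n0, b0⟩ := h
  have proj : ∀ {f : ℝ → E3} {f' : E3} {x : ℝ}, HasDerivAt f f' x →
      HasDerivAt (fun x => f x j) (f' j) x := fun {f f' x} hf =>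
    (EuclideanSpace.proj j : E3 →L[ℝ] ℝ).hasFDerivAt.comp_hasDerivAt x hf
  have hm' : ∀ x, HasDerivAt (fun x => m x j) (curv α c x * n x j) x := fun x => proj (hm x)
  have hn' : ∀ x, HasDerivAt (fun x => n x j)
      (-curv α c x * m x j + β * x / 2 * b x j) x := fun x => proj (hn x)
  have hb' : ∀ x, HasDerivAt (fun x => b x j) (-(β * x / 2) * n x j) x := fun x => proj (hb x)
  refine ⟨hm', hn', hb', fun x => ?_⟩
  have hd : ∀ x, HasDerivAt (fun x => m x j ^ 2 + n x j ^ 2 + b x j ^ 2) 0 x := fun x => by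
    refine ((((hm' x).fun_pow 2).fun_add ((hn' x).fun_pow 2)).fun_add
      ((hb' x).fun_pow 2)).congr_deriv ?_
    push_cast; ring
  have hconst := is_const_of_deriv_eq_zero (fun x => (hd x).differentiableAt)
    (fun x => (hd x).deriv) x 0
  refine hconst.trans ?_
  simp only [m0, n0, b0, e1, e2, e3]
  fin_cases j <;> simp
/-- asymptotics of the expander profile `m_{c,α}` as `s → +∞`, with an error
constant `C(c)` depending only on `c` and not on `α`. -/
theorem expander_profile_asymptotics
    (c : ℝ) (hc : 0 < c) :
    ∃ C : ℝ, 0 < C ∧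
      ∀ α ∈ Set.Icc (0 : ℝ) 1, ∀ β : ℝ, β = Real.sqrt (1 - α ^ 2) →
        ∀ m n b : ℝ → E3, IsSF α β c m n b →
          ∀ A : E3, Tendsto m atTop (nhds A) →
            ∃ a : Fin 3 → ℝ, (∀ j, a j ∈ Set.Ico 0 (2 * π)) ∧
              ∀ s : ℝ, 4 * Real.sqrt (8 + c ^ 2) ≤ s → ∀ j : Fin 3,
                |m s j - A j
                    + (2 * c / s) * Real.sqrt (1 - (A j) ^ 2) * Real.exp (-α * s ^ 2 / 4) *
                        (α * Real.sin (phase α β c (a j) s)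
                          + β * Real.cos (phase α β c (a j) s))
                    + (2 * c ^ 2 / s ^ 2) * A j * Real.exp (-α * s ^ 2 / 2)|
                  ≤ C * Real.exp (-α * s ^ 2 / 4) / s ^ 3 := by
  obtain ⟨C, hC, hmain⟩ := coord_asymptotics hc
  refine ⟨C * c, by positivity, fun α hα β hβ m n b h A hA => ?_⟩
  have hαβ : α ^ 2 + β ^ 2 = 1 := by
    rw [hβ, Real.sq_sqrt (by nlinarith [hα.1, hα.2])]; ring
  have hlim : ∀ j, Tendsto (fun x => m x j) atTop (𝓝 (A j)) := fun j =>
    ((EuclideanSpace.proj j : E3 →L[ℝ] ℝ).continuous.tendsto A).comp hA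
  choose a ha hs using fun j => hmain α β hα.1 hαβ _ _ _ (h.coord j) (A j) (hlim j)
  refine ⟨a, ha, fun s hs₀ j => ?_⟩
  have hexp : Real.exp (-α * s ^ 2 / 2) = Real.exp (-α * s ^ 2 / 4) ^ 2 := by
    rw [← Real.exp_nat_mul]; congr 1; push_cast; ring
  convert hs j s hs₀ using 1
  · rw [hexp]
    unfold curv
    congr 1
    ring
  · unfold curv
    ring
end
end

section
/- For α ∈ [0,1], β = √(1−α²), c > 0, let A⁺_{c,α} ∈ S² be the limit at +∞ of the expander profile m_{c,α}, and A⁻_{c,α} = (A₁⁺, −A₂⁺, −A₃⁺). Then: (1) for every α ∈ (0,1] there exists c* > 0 (depending on α) such that A⁺_{c,α} ≠ A⁻_{c,α} for all c ∈ (0, c*); (2) for every c > 0 there exists α₀* > 0 such that A⁺_{c,α} ≠ A⁻_{c,α} for all α ∈ (0, α₀*); (3) for every c > 0 with c ∉ { n√π : n ∈ ℕ } there exists α₁* ∈ (0,1) such that A⁺_{c,α} ≠ A⁻_{c,α} for all α ∈ (α₁*, 1). -/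
noncomputable section

open Real MeasureTheory Filter Topology

/-- The vector `A⁻ = (A₁, -A₂, -A₃)` obtained from `A⁺ = (A₁, A₂, A₃)`. -/
def flipA (A : E3) : E3 := toE3 ![A 0, -(A 1), -(A 2)]

/-- `A⁺_{c,α} ≠ A⁻_{c,α}`: every Serret–Frenet expander profile with parameters `(c, α)`
has distinct limit vectors at `±∞`. -/
def JumpAt (α c : ℝ) : Prop :=
  ∀ m n b : ℝ → E3, IsSF α (Real.sqrt (1 - α ^ 2)) c m n b →
    ∀ A : E3, Tendsto m atTop (nhds A) → A ≠ flipA A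

/-- The unit complex number `e^{3πi/4}`, a square root of `-i` with negative real part. -/
def rayDir : ℂ := ⟨-(√2 / 2), √2 / 2⟩

lemma rayDir_sq : rayDir * rayDir = -Complex.I := by
  have h : √2 * √2 = 2 := Real.mul_self_sqrt (by norm_num)
  apply Complex.ext
  · simp [rayDir]
  · simp [rayDir]; nlinarith

lemma rayDir_ne_zero : rayDir ≠ 0 := by
  intro h
  have := rayDir_sq
  simp [h] at this

lemma norm_rayDir : ‖rayDir‖ = 1 := by
  have h : ‖rayDir‖ * ‖rayDir‖ = 1 := by
    rw [← norm_mul, rayDir_sq]; simp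
  nlinarith [norm_nonneg rayDir]

/-- The integrand of the parabolic cylinder integral. -/
def cylKernel (σ : ℂ) (x t : ℝ) : ℂ :=
  (t : ℂ) ^ (σ - 1) * Complex.exp (rayDir * x * t - (t : ℂ) ^ 2)

/-- The parabolic cylinder integral `∫₀^∞ t^{σ-1} exp(e^{3πi/4} x t - t²) dt`. -/
def cylInt (σ : ℂ) (x : ℝ) : ℂ := ∫ t in Set.Ioi (0 : ℝ), cylKernel σ x t

lemma norm_cylKernel (σ : ℂ) (x : ℝ) {t : ℝ} (ht : 0 < t) :
    ‖cylKernel σ x t‖ = t ^ (σ.re - 1) * Real.exp (-(√2 / 2) * x * t - t ^ 2) := by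
  rw [cylKernel, norm_mul, Complex.norm_cpow_eq_rpow_re_of_pos ht, Complex.norm_exp]
  simp [rayDir, ← Complex.ofReal_pow]

lemma cylKernel_add_one (σ : ℂ) (x : ℝ) {t : ℝ} (ht : 0 < t) :
    cylKernel (σ + 1) x t = t * cylKernel σ x t := by
  have ht' : (t : ℂ) ≠ 0 := by exact_mod_cast ht.ne'
  rw [cylKernel, cylKernel, show σ + 1 - 1 = (σ - 1) + 1 by ring, Complex.cpow_add _ _ ht',
    Complex.cpow_one]
  ring

lemma continuousOn_cylKernel (σ : ℂ) (x : ℝ) : ContinuousOn (cylKernel σ x) (Set.Ioi 0) := by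
  intro t ht
  have ht' : (t : ℝ) ≠ 0 := ne_of_gt ht
  refine ContinuousAt.continuousWithinAt ?_
  unfold cylKernel
  refine ContinuousAt.mul (Complex.continuousAt_ofReal_cpow_const _ _ (Or.inr ht')) ?_
  fun_prop

lemma aestronglyMeasurable_cylKernel (σ : ℂ) (x : ℝ) :
    AEStronglyMeasurable (cylKernel σ x) (volume.restrict (Set.Ioi 0)) :=
  (continuousOn_cylKernel σ x).aestronglyMeasurable measurableSet_Ioi

/-- An integrable majorant of `cylKernel σ x` that is uniform for `x ≥ -ρ`. -/
def cylBound (a ρ t : ℝ) : ℝ := Real.exp (ρ ^ 2) * (t ^ (a - 1) * Real.exp (-(1 / 2) * t ^ 2))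

lemma integrableOn_cylBound {a : ℝ} (ha : 0 < a) (ρ : ℝ) :
    IntegrableOn (cylBound a ρ) (Set.Ioi 0) :=
  (integrableOn_rpow_mul_exp_neg_mul_sq (by norm_num) (by linarith)).const_mul _

lemma norm_cylKernel_le (σ : ℂ) {x ρ : ℝ} (hx : -ρ ≤ x) {t : ℝ} (ht : 0 < t) :
    ‖cylKernel σ x t‖ ≤ cylBound σ.re ρ t := by
  rw [norm_cylKernel σ x ht, cylBound, mul_left_comm, ← Real.exp_add]
  have h2 : √2 * √2 = 2 := Real.mul_self_sqrt (by norm_num)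
  have h0 := Real.sqrt_nonneg 2
  gcongr
  have h1 : -(√2 / 2) * x * t ≤ (√2 / 2) * ρ * t := by
    have : 0 ≤ √2 / 2 * t * (x + ρ) := by
      have : 0 ≤ x + ρ := by linarith
      positivity
    nlinarith
  nlinarith [sq_nonneg (ρ - √2 / 2 * t), sq_nonneg ρ]

lemma integrableOn_cylKernel {σ : ℂ} (hσ : 0 < σ.re) (x : ℝ) :
    IntegrableOn (cylKernel σ x) (Set.Ioi 0) := by
  refine (integrableOn_cylBound hσ |x|).mono' (aestronglyMeasurable_cylKernel σ x) ?_
  filter_upwards [ae_restrict_mem measurableSet_Ioi] with t ht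
  exact norm_cylKernel_le σ (neg_abs_le x) ht

lemma hasDerivAt_cylInt {σ : ℂ} (hσ : 0 < σ.re) (x : ℝ) :
    HasDerivAt (cylInt σ) (rayDir * cylInt (σ + 1) x) x := by
  have hσ' : 0 < (σ + 1).re := by simp; linarith
  have key := hasDerivAt_integral_of_dominated_loc_of_deriv_le
    (μ := volume.restrict (Set.Ioi (0 : ℝ))) (F := fun y t => cylKernel σ y t)
    (F' := fun y t => rayDir * cylKernel (σ + 1) y t) (x₀ := x)
    (s := Metric.ball x 1) (bound := cylBound (σ + 1).re (|x| + 1))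
    (Metric.ball_mem_nhds x one_pos)
    (Eventually.of_forall fun y => aestronglyMeasurable_cylKernel σ y)
    (integrableOn_cylKernel hσ x)
    ((aestronglyMeasurable_cylKernel (σ + 1) x).const_mul _)
    ?_ (integrableOn_cylBound hσ' _) ?_
  · have h := key.2
    rw [integral_const_mul] at h
    exact h
  · filter_upwards [ae_restrict_mem measurableSet_Ioi] with t ht y hy
    rw [norm_mul, norm_rayDir, one_mul]
    refine norm_cylKernel_le _ ?_ ht
    rw [Metric.mem_ball, Real.dist_eq] at hy
    have := abs_lt.1 hy
    have := neg_abs_le x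
    linarith
  · filter_upwards [ae_restrict_mem measurableSet_Ioi] with t ht y _
    rw [cylKernel_add_one σ y ht]
    unfold cylKernel
    have h1 : HasDerivAt (fun y : ℝ => rayDir * (y : ℂ) * t - (t : ℂ) ^ 2) (rayDir * t) y := by
      have := ((Complex.ofRealCLM.hasDerivAt (x := y)).const_mul rayDir).mul_const (t : ℂ)
      simpa using this.sub_const ((t : ℂ) ^ 2)
    refine (h1.cexp.const_mul ((t : ℂ) ^ (σ - 1))).congr_deriv ?_
    ring

lemma cylInt_recurrence {σ : ℂ} (hσ : 0 < σ.re) (x : ℝ) :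
    2 * cylInt (σ + 1 + 1) x = rayDir * x * cylInt (σ + 1) x + σ * cylInt σ x := by
  have hσ0 : σ ≠ 0 := by rintro rfl; simp at hσ
  have hσ1 : 0 < (σ + 1).re := by simp; linarith
  have hσ2 : 0 < (σ + 1 + 1).re := by simp; linarith
  have i0 := (integrableOn_cylKernel hσ x).const_mul σ
  have i1 := (integrableOn_cylKernel hσ1 x).const_mul (rayDir * x)
  have i2 := (integrableOn_cylKernel hσ2 x).const_mul 2
  have hf' : IntegrableOn (fun t => rayDir * x * cylKernel (σ + 1) x t + σ * cylKernel σ x t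
      - 2 * cylKernel (σ + 1 + 1) x t) (Set.Ioi 0) := (i1.add i0).sub i2
  have hd : ∀ t ∈ Set.Ioi (0 : ℝ), HasDerivAt (cylKernel (σ + 1) x)
      (rayDir * x * cylKernel (σ + 1) x t + σ * cylKernel σ x t
      - 2 * cylKernel (σ + 1 + 1) x t) t := by
    intro t ht
    rw [cylKernel_add_one (σ + 1) x ht, cylKernel_add_one σ x ht]
    have ht' : (t : ℂ) ≠ 0 := by exact_mod_cast (ne_of_gt ht)
    have h1 : HasDerivAt (fun s : ℝ => rayDir * (x : ℂ) * s - (s : ℂ) ^ 2)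
        (rayDir * x - 2 * t) t := by
      have h0 := Complex.ofRealCLM.hasDerivAt (x := t)
      simpa using (h0.const_mul (rayDir * x)).fun_sub (h0.fun_pow 2)
    have h2 := hasDerivAt_ofReal_cpow_const (x := t) (ne_of_gt ht) hσ0
    have h3 := h2.mul h1.cexp
    have e : cylKernel (σ + 1) x = (fun y : ℝ => (y : ℂ) ^ σ) *
        fun s : ℝ => Complex.exp (rayDir * (x : ℂ) * s - (s : ℂ) ^ 2) := by
      ext s; simp [cylKernel]
    rw [e]
    refine h3.congr_deriv ?_
    have e2 : (t : ℂ) ^ σ = t * (t : ℂ) ^ (σ - 1) := by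
      rw [Complex.cpow_sub _ _ ht', Complex.cpow_one]; field_simp
    rw [e2, cylKernel]
    ring
  have hc : ContinuousWithinAt (cylKernel (σ + 1) x) (Set.Ici 0) 0 := by
    refine ContinuousAt.continuousWithinAt ?_
    unfold cylKernel
    refine ContinuousAt.mul
      (Complex.continuousAt_ofReal_cpow_const _ _ (Or.inl (by simpa using hσ))) ?_
    fun_prop
  have hlim := tendsto_zero_of_hasDerivAt_of_integrableOn_Ioi hd hf'
    (integrableOn_cylKernel hσ1 x)
  have h := integral_Ioi_of_hasDerivAt_of_tendsto hc hd hf' hlim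
  have h0 : cylKernel (σ + 1) x 0 = 0 := by
    simp [cylKernel, Complex.zero_cpow hσ0]
  rw [h0, sub_zero] at h
  have e := integral_sub (i1.add i0) i2
  simp only [Pi.add_apply] at e
  rw [h] at e
  have e' := integral_add i1 i0
  rw [e', integral_const_mul, integral_const_mul, integral_const_mul] at e
  unfold cylInt
  linear_combination e

lemma tendsto_cylInt {σ : ℂ} (hσ : 0 < σ.re) : Tendsto (cylInt σ) atTop (𝓝 0) := by
  have h := tendsto_integral_filter_of_dominated_convergence
    (μ := volume.restrict (Set.Ioi (0 : ℝ))) (l := atTop) (F := fun x t => cylKernel σ x t)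
    (f := fun _ => (0 : ℂ)) (cylBound σ.re 0)
    (Eventually.of_forall fun y => aestronglyMeasurable_cylKernel σ y) ?_
    (integrableOn_cylBound hσ _) ?_
  · rw [integral_zero] at h
    exact h
  · filter_upwards [eventually_ge_atTop 0] with x hx
    filter_upwards [ae_restrict_mem measurableSet_Ioi] with t ht
    exact norm_cylKernel_le σ (by simpa using hx) ht
  · filter_upwards [ae_restrict_mem measurableSet_Ioi] with t ht
    rw [tendsto_zero_iff_norm_tendsto_zero]
    have e : (fun x => ‖cylKernel σ x t‖) =
        fun x => t ^ (σ.re - 1) * Real.exp (-(√2 / 2) * x * t - t ^ 2) := by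
      ext x; exact norm_cylKernel σ x ht
    rw [e, ← mul_zero (t ^ (σ.re - 1))]
    refine Tendsto.const_mul _ (Real.tendsto_exp_atBot.comp ?_)
    have ht0 : 0 < t := ht
    have hneg : -(√2 / 2) * t < 0 := by
      have : 0 < √2 := by positivity
      have : 0 < √2 / 2 * t := by positivity
      linarith
    have := (tendsto_id.const_mul_atTop_of_neg (r := -(√2 / 2) * t) hneg :
      Tendsto (fun x : ℝ => -(√2 / 2) * t * x) atTop atBot)
    refine (tendsto_atBot_add_const_right _ (-t ^ 2) this).congr fun x => ?_
    ring

lemma cylInt_zero_ne_zero {σ : ℂ} (hσ : 0 < σ.re) : cylInt σ 0 ≠ 0 := by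
  have h : cylInt σ 0 = mellin (fun t : ℝ => ((Real.exp (-(t ^ (2 : ℝ))) : ℝ) : ℂ)) σ := by
    unfold cylInt mellin
    refine setIntegral_congr_fun measurableSet_Ioi fun t _ => ?_
    simp [cylKernel]
  have h2 := mellin_comp_rpow (fun t : ℝ => ((Real.exp (-t) : ℝ) : ℂ)) σ 2
  have hre : 0 < (σ / ((2 : ℝ) : ℂ)).re := by
    rw [Complex.div_ofReal_re]; positivity
  rw [h, h2, ← Complex.GammaIntegral_eq_mellin, ← Complex.Gamma_eq_integral hre]
  exact smul_ne_zero (by norm_num) (Complex.Gamma_ne_zero_of_re_pos hre)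

/-- `(p, q, r)` is a (scalar) solution of the Serret–Frenet system with curvature `k` and
torsion `τ`. -/
structure SFSol (k τ p q r : ℝ → ℝ) : Prop where
  deriv_p : ∀ x, HasDerivAt p (k x * q x) x
  deriv_q : ∀ x, HasDerivAt q (-(k x * p x) + τ x * r x) x
  deriv_r : ∀ x, HasDerivAt r (-(τ x * q x)) x

namespace SFSol

variable {k τ p q r k' τ' p' q' r' : ℝ → ℝ}

lemma hasDerivAt_pairing (h : SFSol k τ p q r) (h' : SFSol k' τ' p' q' r') (x : ℝ) :
    HasDerivAt (fun x => p x * p' x + q x * q' x + r x * r' x)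
      ((k x - k' x) * (q x * p' x - p x * q' x) + (τ x - τ' x) * (r x * q' x - q x * r' x)) x := by
  refine ((((h.deriv_p x).fun_mul (h'.deriv_p x)).fun_add
    ((h.deriv_q x).fun_mul (h'.deriv_q x))).fun_add
    ((h.deriv_r x).fun_mul (h'.deriv_r x))).congr_deriv ?_
  ring

lemma pairing_eq (h : SFSol k τ p q r) (h' : SFSol k τ p' q' r') (x : ℝ) :
    p x * p' x + q x * q' x + r x * r' x = p 0 * p' 0 + q 0 * q' 0 + r 0 * r' 0 := by
  have hd : ∀ y, HasDerivAt (fun x => p x * p' x + q x * q' x + r x * r' x) 0 y := fun y =>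
    (h.hasDerivAt_pairing h' y).congr_deriv (by ring)
  exact is_const_of_deriv_eq_zero (fun y => (hd y).differentiableAt) (fun y => (hd y).deriv) x 0

/-- Two unit-type solutions of nearby systems have an almost conserved pairing. -/
lemma abs_pairing_sub_le (h : SFSol k τ p q r) (h' : SFSol k' τ' p' q' r') {ρ δ X : ℝ}
    (hn : ∀ x, p x ^ 2 + q x ^ 2 + r x ^ 2 = 1)
    (hn' : ∀ x, p' x ^ 2 + q' x ^ 2 + r' x ^ 2 = ρ ^ 2) (hρ : 0 ≤ ρ) (hX : 0 ≤ X)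
    (hδ : ∀ x ∈ Set.Icc 0 X, |k x - k' x| + |τ x - τ' x| ≤ δ) :
    |p X * p' X + q X * q' X + r X * r' X - (p 0 * p' 0 + q 0 * q' 0 + r 0 * r' 0)|
      ≤ 2 * ρ * δ * X := by
  have key := Convex.norm_image_sub_le_of_norm_hasDerivWithin_le (s := Set.Icc 0 X)
    (C := 2 * ρ * δ)
    (fun x _ => (h.hasDerivAt_pairing h' x).hasDerivWithinAt) ?_ (convex_Icc 0 X)
    (Set.left_mem_Icc.2 hX) (Set.right_mem_Icc.2 hX)
  · simpa [abs_of_nonneg hX] using key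
  · intro x hx
    have hp : |p x| ≤ 1 := abs_le_one_iff_mul_self_le_one.2 (by
      nlinarith [hn x, sq_nonneg (q x), sq_nonneg (r x)])
    have hq : |q x| ≤ 1 := abs_le_one_iff_mul_self_le_one.2 (by
      nlinarith [hn x, sq_nonneg (p x), sq_nonneg (r x)])
    have hr : |r x| ≤ 1 := abs_le_one_iff_mul_self_le_one.2 (by
      nlinarith [hn x, sq_nonneg (q x), sq_nonneg (p x)])
    have hp' : |p' x| ≤ ρ := abs_le_of_sq_le_sq (by
      nlinarith [hn' x, sq_nonneg (q' x), sq_nonneg (r' x)]) hρ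
    have hq' : |q' x| ≤ ρ := abs_le_of_sq_le_sq (by
      nlinarith [hn' x, sq_nonneg (p' x), sq_nonneg (r' x)]) hρ
    have hr' : |r' x| ≤ ρ := abs_le_of_sq_le_sq (by
      nlinarith [hn' x, sq_nonneg (q' x), sq_nonneg (p' x)]) hρ
    have aux : ∀ a b c d : ℝ, |a| ≤ 1 → |b| ≤ ρ → |c| ≤ 1 → |d| ≤ ρ →
        |a * b - c * d| ≤ 2 * ρ := by
      intro a b c d ha hb hc hd
      calc |a * b - c * d| ≤ |a * b| + |c * d| := abs_sub _ _
        _ = |a| * |b| + |c| * |d| := by rw [abs_mul, abs_mul]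
        _ ≤ 1 * ρ + 1 * ρ := by gcongr
        _ = 2 * ρ := by ring
    rw [Real.norm_eq_abs]
    calc _ ≤ |(k x - k' x) * (q x * p' x - p x * q' x)|
          + |(τ x - τ' x) * (r x * q' x - q x * r' x)| := abs_add_le _ _
      _ = |k x - k' x| * |q x * p' x - p x * q' x|
          + |τ x - τ' x| * |r x * q' x - q x * r' x| := by rw [abs_mul, abs_mul]
      _ ≤ |k x - k' x| * (2 * ρ) + |τ x - τ' x| * (2 * ρ) := by
          gcongr
          · exact aux _ _ _ _ hq hp' hp hq'
          · exact aux _ _ _ _ hr hq' hq hr'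
      _ = 2 * ρ * (|k x - k' x| + |τ x - τ' x|) := by ring
      _ ≤ 2 * ρ * δ := by gcongr; exact hδ x hx

/-- If the limit system has a solution that tends to a multiple of the first axis without having
started on it, then no solution of a nearby system that starts at the first axis ends there. -/
lemma exists_abs_limit_ne_one (h' : SFSol k' τ' p' q' r') {ρ C : ℝ} (hρ : 0 ≤ ρ)
    (hn' : ∀ x, p' x ^ 2 + q' x ^ 2 + r' x ^ 2 = ρ ^ 2) (h0 : |p' 0| < ρ)
    (hq' : Tendsto q' atTop (𝓝 0)) (hr' : Tendsto r' atTop (𝓝 0)) :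
    ∃ X > 0, ∃ δ > 0, ∀ (k τ p q r : ℝ → ℝ) (A : ℝ), SFSol k τ p q r →
      p 0 = 1 → q 0 = 0 → r 0 = 0 →
      (∀ x ∈ Set.Icc 0 X, |k x - k' x| + |τ x - τ' x| ≤ δ) →
      (∀ y ≥ X, |p y - p X| ≤ C / X) → Tendsto p atTop (𝓝 A) → |A| ≠ 1 := by
  have hp' : Tendsto (fun x => |p' x|) atTop (𝓝 ρ) := by
    have h1 : Tendsto (fun x => √(ρ ^ 2 - q' x ^ 2 - r' x ^ 2)) atTop
        (𝓝 (√(ρ ^ 2 - 0 ^ 2 - 0 ^ 2))) :=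
      ((tendsto_const_nhds.sub (hq'.pow 2)).sub (hr'.pow 2)).sqrt
    have e : √(ρ ^ 2 - 0 ^ 2 - 0 ^ 2) = ρ := by simp [Real.sqrt_sq hρ]
    rw [e] at h1
    refine h1.congr fun x => ?_
    rw [← Real.sqrt_sq_eq_abs]
    congr 1
    linarith [hn' x]
  have hlim : Tendsto (fun X => |p' X| - |q' X| - |r' X| - ρ * (C / X)) atTop (𝓝 ρ) := by
    have hC : Tendsto (fun X : ℝ => C / X) atTop (𝓝 0) := tendsto_const_nhds.div_atTop tendsto_id
    have := ((hp'.sub hq'.abs).sub hr'.abs).sub (hC.const_mul ρ)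
    simpa using this
  obtain ⟨X, hX, hX0⟩ := ((hlim.eventually_const_lt h0).and (eventually_gt_atTop 0)).exists
  set η := |p' X| - |q' X| - |r' X| - ρ * (C / X) - |p' 0| with hη
  have hη0 : 0 < η := by linarith
  refine ⟨X, hX0, η / (2 * (2 * ρ * X + 1)), by positivity, ?_⟩
  intro k τ p q r A h hp0 hq0 hr0 hδ htail hA hA1
  have hn : ∀ x, p x ^ 2 + q x ^ 2 + r x ^ 2 = 1 := by
    intro x
    have := h.pairing_eq h x
    rw [hp0, hq0, hr0] at this
    nlinarith
  have hpair := h.abs_pairing_sub_le h' hn hn' hρ hX0.le hδ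
  have hδX : 2 * ρ * (η / (2 * (2 * ρ * X + 1))) * X < η := by
    have : 2 * ρ * (η / (2 * (2 * ρ * X + 1))) * X
        = η * ((2 * ρ * X) / (2 * (2 * ρ * X + 1))) := by
      field_simp
    rw [this]
    have h1 : (2 * ρ * X) / (2 * (2 * ρ * X + 1)) < 1 := by
      rw [div_lt_one (by positivity)]
      have : 0 ≤ 2 * ρ * X := by positivity
      linarith
    nlinarith
  have hlimA : |A - p X| ≤ C / X := by
    refine le_of_tendsto (hA.sub_const (p X)).abs ?_
    filter_upwards [eventually_ge_atTop X] with y hy using htail y hy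
  rw [hp0, hq0, hr0] at hpair
  have hq : |q X| ≤ 1 := abs_le_one_iff_mul_self_le_one.2 (by
    nlinarith [hn X, sq_nonneg (p X), sq_nonneg (r X)])
  have hr : |r X| ≤ 1 := abs_le_one_iff_mul_self_le_one.2 (by
    nlinarith [hn X, sq_nonneg (q X), sq_nonneg (p X)])
  have hp'X : |p' X| ≤ ρ := abs_le_of_sq_le_sq (by
    nlinarith [hn' X, sq_nonneg (q' X), sq_nonneg (r' X)]) hρ
  have b1 : |q X * q' X| ≤ |q' X| := by
    rw [abs_mul]; nlinarith [abs_nonneg (q' X)]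
  have b2 : |r X * r' X| ≤ |r' X| := by
    rw [abs_mul]; nlinarith [abs_nonneg (r' X)]
  have b3 : |(A - p X) * p' X| ≤ ρ * (C / X) := by
    rw [abs_mul, mul_comm]
    gcongr
  have b4 : |p' X| = |A * p' X| := by rw [abs_mul, hA1, one_mul]
  have b5 : A * p' X = (A - p X) * p' X + (p X * p' X + q X * q' X + r X * r' X
      - (1 * p' 0 + 0 * q' 0 + 0 * r' 0)) + p' 0 - q X * q' X - r X * r' X := by ring
  have b6 : |p' X| ≤ ρ * (C / X) + 2 * ρ * (η / (2 * (2 * ρ * X + 1))) * X + |p' 0|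
      + |q' X| + |r' X| := by
    rw [b4, b5]
    refine (abs_sub _ _).trans (add_le_add ?_ b2)
    refine (abs_sub _ _).trans (add_le_add ?_ b1)
    refine (abs_add_le _ _).trans (add_le_add ?_ le_rfl)
    exact (abs_add_le _ _).trans (add_le_add b3 hpair)
  linarith

end SFSol

/-- For a curvature that decreases relative to the torsion, `p` converges at a uniform rate. -/
lemma SFSol.tail_of_torsion {c α β : ℝ} {p q r : ℝ → ℝ} (hc : 0 < c) (hα : 0 ≤ α) (hβ : 0 < β)
    (h : SFSol (fun x => c * Real.exp (-α * x ^ 2 / 4)) (fun x => β * x / 2) p q r)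
    (hr : ∀ x, |r x| ≤ 1) {X y : ℝ} (hX : 0 < X) (hy : X ≤ y) :
    |p y - p X| ≤ (4 * c / β) / X := by
  set H : ℝ → ℝ := fun x => 2 * (c * Real.exp (-α * x ^ 2 / 4)) / (β * x) with hH
  set H' : ℝ → ℝ :=
    fun x => -(2 * c / β) * Real.exp (-α * x ^ 2 / 4) * (α / 2 + 1 / x ^ 2) with hH'
  have hHd : ∀ x, 0 < x → HasDerivAt H (H' x) x := by
    intro x hx
    have h1 : HasDerivAt (fun x : ℝ => -α * x ^ 2 / 4) (-α * x / 2) x := by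
      refine (((hasDerivAt_id x).fun_pow 2).const_mul (-α) |>.div_const 4).congr_deriv ?_
      simp; ring
    have h2 : HasDerivAt (fun x : ℝ => β * x) β x := by
      simpa using (hasDerivAt_id x).const_mul β
    refine (((h1.exp.const_mul c).const_mul 2).fun_div h2 (by positivity)).congr_deriv ?_
    simp only [hH']
    field_simp
    ring
  have hG : ∀ x, 0 < x → HasDerivAt (fun x => p x + H x * r x) (H' x * r x) x := by
    intro x hx
    refine ((h.deriv_p x).fun_add ((hHd x hx).fun_mul (h.deriv_r x))).congr_deriv ?_
    simp only [hH]
    field_simp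
    ring
  have hH'neg : ∀ x, H' x ≤ 0 := by
    intro x
    have : 0 ≤ (2 * c / β) * Real.exp (-α * x ^ 2 / 4) * (α / 2 + 1 / x ^ 2) := by positivity
    simp only [hH']; linarith
  have hHpos : ∀ x, 0 < x → 0 ≤ H x := fun x hx => by simp only [hH]; positivity
  have hHle : H X ≤ (2 * c / β) / X := by
    simp only [hH]
    rw [div_div]
    gcongr
    have : Real.exp (-α * X ^ 2 / 4) ≤ 1 := Real.exp_le_one_iff.2 (by
      have : 0 ≤ α * X ^ 2 := by positivity
      linarith)
    nlinarith
  have habs : ∀ x, |H' x * r x| ≤ -H' x := fun x => by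
    rw [abs_mul, abs_of_nonpos (hH'neg x)]
    nlinarith [hr x, hH'neg x]
  have mono1 : MonotoneOn (fun x => -H x - (p x + H x * r x)) (Set.Ici X) := by
    refine monotoneOn_of_hasDerivWithinAt_nonneg (convex_Ici X)
      (f' := fun x => -H' x - H' x * r x) ?_ ?_ ?_
    · intro x hx
      have hx' := hX.trans_le hx
      exact ((hHd x hx').fun_neg.fun_sub (hG x hx')).continuousAt.continuousWithinAt
    · intro x hx
      have hx' := hX.trans_le (interior_subset hx)
      exact ((hHd x hx').fun_neg.fun_sub (hG x hx')).hasDerivWithinAt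
    · intro x _
      linarith [(abs_le.1 (habs x)).2]
  have mono2 : MonotoneOn (fun x => -H x + (p x + H x * r x)) (Set.Ici X) := by
    refine monotoneOn_of_hasDerivWithinAt_nonneg (convex_Ici X)
      (f' := fun x => -H' x + H' x * r x) ?_ ?_ ?_
    · intro x hx
      have hx' := hX.trans_le hx
      exact ((hHd x hx').fun_neg.fun_add (hG x hx')).continuousAt.continuousWithinAt
    · intro x hx
      have hx' := hX.trans_le (interior_subset hx)
      exact ((hHd x hx').fun_neg.fun_add (hG x hx')).hasDerivWithinAt
    · intro x _
      linarith [(abs_le.1 (habs x)).1]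
  have m1 := mono1 (Set.mem_Ici.2 le_rfl) hy hy
  have m2 := mono2 (Set.mem_Ici.2 le_rfl) hy hy
  simp only at m1 m2
  have bX : |H X * r X| ≤ H X := by
    rw [abs_mul, abs_of_nonneg (hHpos X hX)]
    nlinarith [hr X, hHpos X hX]
  have bY : |H y * r y| ≤ H y := by
    rw [abs_mul, abs_of_nonneg (hHpos y (hX.trans_le hy))]
    nlinarith [hr y, hHpos y (hX.trans_le hy)]
  have e : (4 * c / β) / X = 2 * ((2 * c / β) / X) := by ring
  rw [e, abs_le]
  have := abs_le.1 bX
  have := abs_le.1 bY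
  constructor <;> linarith

/-- For an integrable curvature, `p` converges at a uniform rate. -/
lemma SFSol.tail_of_curvature {c α : ℝ} {τ p q r : ℝ → ℝ} (hc : 0 < c) (hα : 1 / 2 ≤ α)
    (h : SFSol (fun x => c * Real.exp (-α * x ^ 2 / 4)) τ p q r)
    (hq : ∀ x, |q x| ≤ 1) {X y : ℝ} (hX : 0 < X) (hy : X ≤ y) :
    |p y - p X| ≤ (8 * c) / X := by
  have hd : ∀ x, 0 < x → HasDerivAt (fun x : ℝ => -(8 * c) / x) (8 * c / x ^ 2) x := by
    intro x hx
    refine ((hasDerivAt_const x (-(8 * c))).fun_div (hasDerivAt_id x) hx.ne').congr_deriv ?_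
    simp
  have hk : ∀ x, 0 < x → |c * Real.exp (-α * x ^ 2 / 4) * q x| ≤ 8 * c / x ^ 2 := by
    intro x hx
    have h1 : Real.exp (-α * x ^ 2 / 4) ≤ 8 / x ^ 2 := by
      have h2 : Real.exp (-α * x ^ 2 / 4) ≤ Real.exp (-(x ^ 2 / 8)) := by
        gcongr
        nlinarith [sq_nonneg x]
      have h3 := Real.add_one_le_exp (x ^ 2 / 8)
      have h4 : Real.exp (-(x ^ 2 / 8)) ≤ (x ^ 2 / 8)⁻¹ := by
        rw [Real.exp_neg]
        gcongr
        linarith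
      calc _ ≤ _ := h2
        _ ≤ _ := h4
        _ = 8 / x ^ 2 := by rw [inv_div]
    have h0 := Real.exp_pos (-α * x ^ 2 / 4)
    rw [abs_mul, abs_of_pos (by positivity : 0 < c * Real.exp (-α * x ^ 2 / 4))]
    calc c * Real.exp (-α * x ^ 2 / 4) * |q x| ≤ c * Real.exp (-α * x ^ 2 / 4) * 1 := by
          gcongr; exact hq x
      _ ≤ c * (8 / x ^ 2) * 1 := by gcongr
      _ = 8 * c / x ^ 2 := by ring
  have mono1 : MonotoneOn (fun x => -(8 * c) / x - p x) (Set.Ici X) := by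
    refine monotoneOn_of_hasDerivWithinAt_nonneg (convex_Ici X)
      (f' := fun x => 8 * c / x ^ 2 - c * Real.exp (-α * x ^ 2 / 4) * q x) ?_ ?_ ?_
    · intro x hx
      exact ((hd x (hX.trans_le hx)).fun_sub (h.deriv_p x)).continuousAt.continuousWithinAt
    · intro x hx
      exact ((hd x (hX.trans_le (interior_subset hx))).fun_sub (h.deriv_p x)).hasDerivWithinAt
    · intro x hx
      linarith [(abs_le.1 (hk x (hX.trans_le (interior_subset hx)))).2]
  have mono2 : MonotoneOn (fun x => -(8 * c) / x + p x) (Set.Ici X) := by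
    refine monotoneOn_of_hasDerivWithinAt_nonneg (convex_Ici X)
      (f' := fun x => 8 * c / x ^ 2 + c * Real.exp (-α * x ^ 2 / 4) * q x) ?_ ?_ ?_
    · intro x hx
      exact ((hd x (hX.trans_le hx)).fun_add (h.deriv_p x)).continuousAt.continuousWithinAt
    · intro x hx
      exact ((hd x (hX.trans_le (interior_subset hx))).fun_add (h.deriv_p x)).hasDerivWithinAt
    · intro x hx
      linarith [(abs_le.1 (hk x (hX.trans_le (interior_subset hx)))).1]
  have m1 := mono1 (Set.mem_Ici.2 le_rfl) hy hy
  have m2 := mono2 (Set.mem_Ici.2 le_rfl) hy hy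
  simp only [neg_div] at m1 m2
  have : 0 ≤ 8 * c / y := by have := hX.trans_le hy; positivity
  rw [abs_le]
  constructor <;> linarith

/-- A solution of the system for `α = 0` that tends to a multiple of the first axis. -/
lemma exists_sfSol_const_curvature {c : ℝ} (hc : 0 < c) :
    ∃ (P Q R : ℝ → ℝ) (ρ : ℝ), 0 ≤ ρ ∧ SFSol (fun _ => c) (fun x => x / 2) P Q R ∧
      (∀ x, P x ^ 2 + Q x ^ 2 + R x ^ 2 = ρ ^ 2) ∧ |P 0| < ρ ∧
      Tendsto Q atTop (𝓝 0) ∧ Tendsto R atTop (𝓝 0) := by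
  have hcC : (c : ℂ) ≠ 0 := by exact_mod_cast hc.ne'
  set σ : ℂ := 1 - (c ^ 2 / 2 : ℝ) * Complex.I with hσdef
  have hσ : 0 < σ.re := by simp [hσdef, -Complex.ofReal_pow]
  have hσ1 : 0 < (σ + 1).re := by rw [Complex.add_re, Complex.one_re]; linarith
  set Y : ℝ → ℂ := cylInt σ with hY
  set U : ℝ → ℂ := fun x => -(2 / c) * (rayDir * cylInt (σ + 1) x + Complex.I * (x / 2) * Y x)
    with hU
  have hYd : ∀ x, HasDerivAt Y (-(c / 2) * U x - Complex.I * (x / 2) * Y x) x := by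
    intro x
    refine (hasDerivAt_cylInt hσ x).congr_deriv ?_
    simp only [hU]
    field_simp
    ring
  have hUd : ∀ x, HasDerivAt U (c / 2 * Y x) x := by
    intro x
    have h1 := (hasDerivAt_cylInt hσ1 x).const_mul rayDir
    have h2 : HasDerivAt (fun y : ℝ => Complex.I * ((y : ℂ) / 2)) (Complex.I * (1 / 2)) x := by
      simpa using ((Complex.ofRealCLM.hasDerivAt (x := x)).div_const 2).const_mul Complex.I
    have h3 := (h1.fun_add (h2.fun_mul (hasDerivAt_cylInt hσ x))).const_mul (-(2 / c) : ℂ)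
    refine h3.congr_deriv ?_
    have hrec := cylInt_recurrence hσ x
    have e : rayDir * (rayDir * cylInt (σ + 1 + 1) x) = -Complex.I * cylInt (σ + 1 + 1) x := by
      rw [← mul_assoc, rayDir_sq]
    rw [e, hY]
    have hσv : σ = 1 - c ^ 2 / 2 * Complex.I := by simp [hσdef]
    have e2 : cylInt (σ + 1 + 1) x
        = (rayDir * x * cylInt (σ + 1) x + (1 - c ^ 2 / 2 * Complex.I) * cylInt σ x) / 2 := by
      rw [← hσv, ← hrec]; ring
    rw [e2]
    field_simp
    linear_combination (-(c : ℂ) ^ 2 * cylInt σ x) * Complex.I_sq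
  have hre : ∀ (f : ℝ → ℂ) (f' : ℂ) (x : ℝ), HasDerivAt f f' x →
      HasDerivAt (fun y => (f y).re) f'.re x := fun f f' x h =>
    Complex.reCLM.hasFDerivAt.comp_hasDerivAt x h
  have him : ∀ (f : ℝ → ℂ) (f' : ℂ) (x : ℝ), HasDerivAt f f' x →
      HasDerivAt (fun y => (f y).im) f'.im x := fun f f' x h =>
    Complex.imCLM.hasFDerivAt.comp_hasDerivAt x h
  have ha : ∀ x, HasDerivAt (fun y => (U y).re) (c / 2 * (Y x).re) x := fun x =>
    (hre _ _ x (hUd x)).congr_deriv (by simp [← Complex.ofReal_ofNat, ← Complex.ofReal_div])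
  have hb : ∀ x, HasDerivAt (fun y => (U y).im) (c / 2 * (Y x).im) x := fun x =>
    (him _ _ x (hUd x)).congr_deriv (by simp [← Complex.ofReal_ofNat, ← Complex.ofReal_div])
  have hd : ∀ x, HasDerivAt (fun y => (Y y).re) (-(c / 2) * (U x).re + x / 2 * (Y x).im) x :=
    fun x => (hre _ _ x (hYd x)).congr_deriv (by
      simp [← Complex.ofReal_ofNat, ← Complex.ofReal_div])
  have he : ∀ x, HasDerivAt (fun y => (Y y).im) (-(c / 2) * (U x).im - x / 2 * (Y x).re) x :=
    fun x => (him _ _ x (hYd x)).congr_deriv (by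
      simp [← Complex.ofReal_ofNat, ← Complex.ofReal_div])
  have hsol : SFSol (fun _ => c) (fun x => x / 2)
      (fun x => (U x).re * (U x).re + (U x).im * (U x).im
        - (Y x).re * (Y x).re - (Y x).im * (Y x).im)
      (fun x => 2 * ((U x).re * (Y x).re + (U x).im * (Y x).im))
      (fun x => 2 * ((U x).re * (Y x).im - (U x).im * (Y x).re)) := by
    refine ⟨fun x => ?_, fun x => ?_, fun x => ?_⟩
    · refine (((((ha x).fun_mul (ha x)).fun_add ((hb x).fun_mul (hb x))).fun_sub
        ((hd x).fun_mul (hd x))).fun_sub ((he x).fun_mul (he x))).congr_deriv ?_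
      ring
    · refine ((((ha x).fun_mul (hd x)).fun_add ((hb x).fun_mul (he x))).const_mul 2).congr_deriv ?_
      ring
    · refine ((((ha x).fun_mul (he x)).fun_sub ((hb x).fun_mul (hd x))).const_mul 2).congr_deriv ?_
      ring
  set ρ : ℝ := (U 0).re * (U 0).re + (U 0).im * (U 0).im
    + (Y 0).re * (Y 0).re + (Y 0).im * (Y 0).im with hρ
  have hρ0 : 0 ≤ ρ := by
    have := mul_self_nonneg (U 0).re
    have := mul_self_nonneg (U 0).im
    have := mul_self_nonneg (Y 0).re
    have := mul_self_nonneg (Y 0).im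
    linarith
  have hcons : ∀ x, (U x).re * (U x).re + (U x).im * (U x).im
      + (Y x).re * (Y x).re + (Y x).im * (Y x).im = ρ := by
    intro x
    have hder : ∀ x, HasDerivAt (fun x => (U x).re * (U x).re + (U x).im * (U x).im
      + (Y x).re * (Y x).re + (Y x).im * (Y x).im) 0 x := fun x =>
      (((((ha x).fun_mul (ha x)).fun_add ((hb x).fun_mul (hb x))).fun_add
        ((hd x).fun_mul (hd x))).fun_add ((he x).fun_mul (he x))).congr_deriv (by ring)
    exact is_const_of_deriv_eq_zero (fun y => (hder y).differentiableAt)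
      (fun y => (hder y).deriv) x 0
  have hUle : ∀ x, |(U x).re| ≤ ρ + 1 ∧ |(U x).im| ≤ ρ + 1 := by
    intro x
    have h := hcons x
    have h1 := mul_self_nonneg (U x).re
    have h2 := mul_self_nonneg (U x).im
    have h3 := mul_self_nonneg (Y x).re
    have h4 := mul_self_nonneg (Y x).im
    constructor <;> refine abs_le_of_sq_le_sq ?_ (by linarith) <;> nlinarith
  have hYre : Tendsto (fun x => (Y x).re) atTop (𝓝 0) := by
    have h := (Complex.continuous_re.tendsto 0).comp (tendsto_cylInt hσ)
    rw [Complex.zero_re] at h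
    exact h
  have hYim : Tendsto (fun x => (Y x).im) atTop (𝓝 0) := by
    have h := (Complex.continuous_im.tendsto 0).comp (tendsto_cylInt hσ)
    rw [Complex.zero_im] at h
    exact h
  have hbd : ∀ f g : ℝ → ℝ, (∀ x, |f x| ≤ ρ + 1) → Tendsto g atTop (𝓝 0) →
      Tendsto (fun x => f x * g x) atTop (𝓝 0) := by
    intro f g hf hg
    refine squeeze_zero_norm (a := fun x => (ρ + 1) * |g x|) (fun x => ?_) ?_
    · rw [Real.norm_eq_abs, abs_mul]
      gcongr
      exact hf x
    · simpa using hg.abs.const_mul (ρ + 1)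
  refine ⟨_, _, _, ρ, hρ0, hsol, fun x => ?_, ?_, ?_, ?_⟩
  · rw [← hcons x]; ring
  · have hY0 : 0 < (Y 0).re * (Y 0).re + (Y 0).im * (Y 0).im := by
      rw [← Complex.normSq_apply]
      exact Complex.normSq_pos.2 (cylInt_zero_ne_zero hσ)
    have hU0 : 0 < (U 0).re * (U 0).re + (U 0).im * (U 0).im := by
      rw [← Complex.normSq_apply]
      refine Complex.normSq_pos.2 ?_
      have h2 : (-(2 / c) : ℂ) ≠ 0 := neg_ne_zero.2 (div_ne_zero two_ne_zero hcC)
      simpa [hU] using ⟨hc.ne', rayDir_ne_zero, cylInt_zero_ne_zero hσ1⟩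
    rw [abs_lt]
    constructor <;> linarith
  · simpa using ((hbd _ _ (fun x => (hUle x).1) hYre).add
      (hbd _ _ (fun x => (hUle x).2) hYim)).const_mul 2
  · simpa using ((hbd _ _ (fun x => (hUle x).1) hYim).sub
      (hbd _ _ (fun x => (hUle x).2) hYre)).const_mul 2

lemma integrableOn_gaussian_quarter {α : ℝ} (hα : 0 < α) :
    IntegrableOn (fun x : ℝ => Real.exp (-α * x ^ 2 / 4)) (Set.Ioi 0) := by
  have h := (integrable_exp_neg_mul_sq (b := α / 4) (by positivity)).integrableOn
    (s := Set.Ioi 0)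
  refine h.congr_fun (fun x _ => ?_) measurableSet_Ioi
  simp only; congr 1; ring

/-- A planar solution of the system for `α = 1` that tends to the first axis. -/
lemma exists_sfSol_zero_torsion {c : ℝ} (hc : 0 < c) (hcπ : ∀ n : ℕ, c ≠ n * √π) :
    ∃ P Q R : ℝ → ℝ, SFSol (fun x => c * Real.exp (-1 * x ^ 2 / 4)) (fun _ => 0) P Q R ∧
      (∀ x, P x ^ 2 + Q x ^ 2 + R x ^ 2 = 1 ^ 2) ∧ |P 0| < 1 ∧
      Tendsto Q atTop (𝓝 0) ∧ Tendsto R atTop (𝓝 0) := by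
  set f : ℝ → ℝ := fun x => c * Real.exp (-1 * x ^ 2 / 4) with hf
  have hfc : Continuous f := by fun_prop
  set θ : ℝ → ℝ := fun x => ∫ t in (0 : ℝ)..x, f t with hθ
  have hθd : ∀ x, HasDerivAt θ (f x) x := fun x =>
    intervalIntegral.integral_hasDerivAt_right (hfc.intervalIntegrable _ _)
      hfc.stronglyMeasurable.stronglyMeasurableAtFilter hfc.continuousAt
  have hfi : ∫ t in Set.Ioi (0 : ℝ), f t = c * √π := by
    have h1 : ∀ t : ℝ, f t = c * Real.exp (-(1 / 4) * t ^ 2) := fun t => by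
      simp only [hf]; congr 2; ring
    simp only [h1]
    rw [integral_const_mul, integral_gaussian_Ioi]
    have : √(π / (1 / 4)) = 2 * √π := by
      rw [show π / (1 / 4) = 2 ^ 2 * π by ring, Real.sqrt_mul (by positivity),
        Real.sqrt_sq (by norm_num)]
    rw [this]; ring
  have hlim : Tendsto θ atTop (𝓝 (c * √π)) := by
    rw [← hfi]
    exact intervalIntegral_tendsto_integral_Ioi 0
      ((integrableOn_gaussian_quarter one_pos).const_mul c) tendsto_id
  have hφ : ∀ x, HasDerivAt (fun x => θ x - c * √π) (f x) x := fun x => (hθd x).sub_const _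
  refine ⟨fun x => Real.cos (θ x - c * √π), fun x => -Real.sin (θ x - c * √π), fun _ => 0,
    ⟨fun x => ?_, fun x => ?_, fun x => ?_⟩, fun x => ?_, ?_, ?_, tendsto_const_nhds⟩
  · exact (hφ x).cos.congr_deriv (by ring)
  · exact (hφ x).sin.fun_neg.congr_deriv (by ring)
  · exact (hasDerivAt_const x (0 : ℝ)).congr_deriv (by ring)
  · have := Real.sin_sq_add_cos_sq (θ x - c * √π)
    linarith
  · have h0 : θ 0 = 0 := by simp [hθ]
    have hsin : Real.sin (c * √π) ≠ 0 := by
      intro h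
      obtain ⟨n, hn⟩ := Real.sin_eq_zero_iff.1 h
      have hsq : √π * √π = π := Real.mul_self_sqrt Real.pi_pos.le
      have hpos : 0 < √π := Real.sqrt_pos.2 Real.pi_pos
      have hcn : c = n * √π := by
        refine mul_right_cancel₀ hpos.ne' ?_
        rw [mul_assoc, hsq, hn]
      have hn0 : 0 ≤ n := by
        by_contra! hneg
        have : (n : ℝ) < 0 := by exact_mod_cast hneg
        nlinarith
      refine hcπ n.toNat ?_
      rw [hcn]
      congr 1
      exact_mod_cast (Int.toNat_of_nonneg hn0).symm
    simp only [h0, zero_sub, Real.cos_neg]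
    have h1 := Real.sin_sq_add_cos_sq (c * √π)
    have h2 : 0 < Real.sin (c * √π) ^ 2 := by positivity
    rw [← sq_lt_one_iff_abs_lt_one]
    linarith
  · have h1 : Tendsto (fun x => θ x - c * √π) atTop (𝓝 0) := by
      simpa using hlim.sub_const (c * √π)
    simpa using ((Real.continuous_sin.tendsto 0).comp h1).neg

/-- The coordinates of a Serret–Frenet frame solve the scalar system. -/
lemma IsSF.sfSol {α β c : ℝ} {m n b : ℝ → E3} (h : IsSF α β c m n b) (j : Fin 3) :
    SFSol (fun x => c * Real.exp (-α * x ^ 2 / 4)) (fun x => β * x / 2)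
      (fun x => m x j) (fun x => n x j) (fun x => b x j) := by
  have key : ∀ (f : ℝ → E3) (f' : E3) (x : ℝ), HasDerivAt f f' x →
      HasDerivAt (fun y => f y j) (f' j) x := fun f f' x hf =>
    (EuclideanSpace.proj (𝕜 := ℝ) j).hasFDerivAt.comp_hasDerivAt x hf
  refine ⟨fun x => ?_, fun x => ?_, fun x => ?_⟩
  · exact (key _ _ x (h.1 x)).congr_deriv (by simp)
  · exact (key _ _ x (h.2.1 x)).congr_deriv (by simp)
  · exact (key _ _ x (h.2.2.1 x)).congr_deriv (by simp)

lemma IsSF.init {α β c : ℝ} {m n b : ℝ → E3} (h : IsSF α β c m n b) (j : Fin 3) :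
    m 0 j = (if j = 0 then 1 else 0) ∧ n 0 j = (if j = 1 then 1 else 0) ∧
      b 0 j = (if j = 2 then 1 else 0) := by
  obtain ⟨-, -, -, h1, h2, h3⟩ := h
  rw [h1, h2, h3]
  fin_cases j <;> simp [e1, e2, e3]

/-- The coordinate triples `(m_j, n_j, b_j)` are unit vectors. -/
lemma IsSF.sq_add_sq_add_sq {α β c : ℝ} {m n b : ℝ → E3} (h : IsSF α β c m n b) (j : Fin 3)
    (x : ℝ) : m x j ^ 2 + n x j ^ 2 + b x j ^ 2 = 1 := by
  have h1 := (h.sfSol j).pairing_eq (h.sfSol j) x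
  obtain ⟨i1, i2, i3⟩ := h.init j
  simp only [i1, i2, i3] at h1
  have e : m x j ^ 2 + n x j ^ 2 + b x j ^ 2 = m x j * m x j + n x j * n x j + b x j * b x j := by
    ring
  rw [e, h1]
  fin_cases j <;> simp

/-- The tangent vector is a unit vector. -/
lemma IsSF.norm_tangent {α β c : ℝ} {m n b : ℝ → E3} (h : IsSF α β c m n b) (x : ℝ) :
    m x 0 ^ 2 + m x 1 ^ 2 + m x 2 ^ 2 = 1 := by
  set O : Matrix (Fin 3) (Fin 3) ℝ := ![fun j => m x j, fun j => n x j, fun j => b x j]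
  have h1 : O.transpose * O = 1 := by
    ext i j
    have hp := (h.sfSol i).pairing_eq (h.sfSol j) x
    obtain ⟨i1, i2, i3⟩ := h.init i
    obtain ⟨j1, j2, j3⟩ := h.init j
    simp only [i1, i2, i3, j1, j2, j3] at hp
    rw [Matrix.mul_apply, Fin.sum_univ_three]
    refine hp.trans ?_
    fin_cases i <;> fin_cases j <;> simp
  have h2 : O * O.transpose = 1 := mul_eq_one_comm.1 h1
  have h3 := congrFun (congrFun h2 0) 0
  rw [Matrix.mul_apply, Fin.sum_univ_three] at h3
  have h4 : m x 0 * m x 0 + m x 1 * m x 1 + m x 2 * m x 2 = 1 := h3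
  linarith

lemma eq_flipA_iff (A : E3) : A = flipA A ↔ A 1 = 0 ∧ A 2 = 0 := by
  constructor
  · intro h
    have h1 := congrArg (fun v : E3 => v 1) h
    have h2 := congrArg (fun v : E3 => v 2) h
    simp [flipA, toE3] at h1 h2
    constructor <;> linarith
  · rintro ⟨h1, h2⟩
    ext j
    fin_cases j <;> simp [flipA, toE3, h1, h2]

lemma tendsto_coord {m : ℝ → E3} {A : E3} (h : Tendsto m atTop (𝓝 A)) (j : Fin 3) :
    Tendsto (fun x => m x j) atTop (𝓝 (A j)) :=
  ((EuclideanSpace.proj (𝕜 := ℝ) j).continuous.tendsto A).comp h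

/-- A profile whose limit has first coordinate different from `±1` jumps. -/
lemma jumpAt_of_abs_limit_ne_one {α c : ℝ}
    (h : ∀ m n b : ℝ → E3, IsSF α (√(1 - α ^ 2)) c m n b →
      ∀ A : E3, Tendsto m atTop (𝓝 A) → |A 0| ≠ 1) : JumpAt α c := by
  intro m n b hsf A hA heq
  obtain ⟨h1, h2⟩ := (eq_flipA_iff A).1 heq
  have hlim := (((tendsto_coord hA 0).pow 2).add ((tendsto_coord hA 1).pow 2)).add
    ((tendsto_coord hA 2).pow 2)
  have h3 : A 0 ^ 2 + A 1 ^ 2 + A 2 ^ 2 = 1 :=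
    tendsto_nhds_unique hlim (tendsto_const_nhds.congr fun x => (hsf.norm_tangent x).symm)
  rw [h1, h2] at h3
  refine h m n b hsf A hA ?_
  simpa using (sq_eq_sq_iff_abs_eq_abs (A 0) 1).1 (by linarith)

lemma abs_le_one_of_sq_add_sq_s14 {p q r : ℝ} (h : p ^ 2 + q ^ 2 + r ^ 2 = 1) :
    |p| ≤ 1 ∧ |q| ≤ 1 ∧ |r| ≤ 1 := by
  refine ⟨?_, ?_, ?_⟩ <;>
  · rw [← sq_le_one_iff_abs_le_one]
    nlinarith [sq_nonneg p, sq_nonneg q, sq_nonneg r]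

/-- A curve whose speed is at most `C` times a curvature of the form `e^{-αx²/4}` travels at most
`C` times its partial integral. -/
lemma norm_le_mul_integral {f f' : ℝ → ℂ} {α C : ℝ} (h0 : f 0 = 0)
    (hd : ∀ x, HasDerivAt f (f' x) x)
    (hb : ∀ x, 0 ≤ x → ‖f' x‖ ≤ C * Real.exp (-α * x ^ 2 / 4)) {x : ℝ} (hx : 0 ≤ x) :
    ‖f x‖ ≤ C * ∫ t in (0 : ℝ)..x, Real.exp (-α * t ^ 2 / 4) := by
  have hc : Continuous fun t : ℝ => Real.exp (-α * t ^ 2 / 4) := by fun_prop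
  refine image_norm_le_of_norm_deriv_right_le_deriv_boundary (a := 0) (b := x)
    (f' := f') (B := fun x => C * ∫ t in (0 : ℝ)..x, Real.exp (-α * t ^ 2 / 4))
    (B' := fun x => C * Real.exp (-α * x ^ 2 / 4))
    (fun y _ => (hd y).continuousAt.continuousWithinAt)
    (fun y _ => (hd y).hasDerivWithinAt) (by simp [h0])
    (fun y => (intervalIntegral.integral_hasDerivAt_right (hc.intervalIntegrable _ _)
      hc.stronglyMeasurable.stronglyMeasurableAtFilter hc.continuousAt).const_mul C)
    (fun y hy => hb y hy.1) ⟨hx, le_rfl⟩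

lemma integral_le_integral_Ioi {α : ℝ} (hα : 0 < α) {x : ℝ} (hx : 0 ≤ x) :
    ∫ t in (0 : ℝ)..x, Real.exp (-α * t ^ 2 / 4) ≤
      ∫ t in Set.Ioi (0 : ℝ), Real.exp (-α * t ^ 2 / 4) := by
  rw [intervalIntegral.integral_of_le hx]
  exact setIntegral_mono_set (integrableOn_gaussian_quarter hα)
    (Eventually.of_forall fun t => (Real.exp_pos _).le)
    (Set.Ioc_subset_Ioi_self.eventuallyLE)

/-- First-order expansion in `c` of the transversal part `A₂ + i A₃` of the limit. -/
lemma IsSF.norm_limit_sub_le {α β c : ℝ} (hα : 0 < α) (hc : 0 < c) {m n b : ℝ → E3}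
    (h : IsSF α β c m n b) {A : E3} (hA : Tendsto m atTop (𝓝 A)) :
    ‖(A 1 + A 2 * Complex.I : ℂ) -
        c * ∫ t in Set.Ioi (0 : ℝ), Complex.exp (-((α - β * Complex.I) / 4) * (t : ℂ) ^ 2)‖
      ≤ 2 * c ^ 2 * (∫ t in Set.Ioi (0 : ℝ), Real.exp (-α * t ^ 2 / 4)) ^ 2 := by
  set K : ℝ := ∫ t in Set.Ioi (0 : ℝ), Real.exp (-α * t ^ 2 / 4) with hK
  set g : ℝ → ℂ := fun t => Complex.exp (-((α - β * Complex.I) / 4) * (t : ℂ) ^ 2) with hg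
  have hof : ∀ (u v : ℝ → ℝ) (u' v' x : ℝ), HasDerivAt u u' x → HasDerivAt v v' x →
      HasDerivAt (fun x => (u x + v x * Complex.I : ℂ)) (u' + v' * Complex.I) x :=
    fun u v u' v' x hu hv => hu.ofReal_comp.add (hv.ofReal_comp.mul_const Complex.I)
  set k : ℝ → ℝ := fun x => c * Real.exp (-α * x ^ 2 / 4) with hk
  set M : ℝ → ℂ := fun x => m x 1 + m x 2 * Complex.I with hM
  set Z : ℝ → ℂ := fun x => n x 1 + n x 2 * Complex.I with hZ
  set B : ℝ → ℂ := fun x => b x 1 + b x 2 * Complex.I with hB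
  have hMd : ∀ x, HasDerivAt M (k x * Z x) x := fun x =>
    (hof _ _ _ _ x ((h.sfSol 1).deriv_p x) ((h.sfSol 2).deriv_p x)).congr_deriv (by
      simp only [hZ, hk]; push_cast; ring)
  have hZd : ∀ x, HasDerivAt Z (-(k x * M x) + (β * x / 2 : ℝ) * B x) x := fun x =>
    (hof _ _ _ _ x ((h.sfSol 1).deriv_q x) ((h.sfSol 2).deriv_q x)).congr_deriv (by
      simp only [hM, hB, hk]; push_cast; ring)
  have hBd : ∀ x, HasDerivAt B (-((β * x / 2 : ℝ) * Z x)) x := fun x =>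
    (hof _ _ _ _ x ((h.sfSol 1).deriv_r x) ((h.sfSol 2).deriv_r x)).congr_deriv (by
      simp only [hZ]; push_cast; ring)
  have hM0 : M 0 = 0 := by simp [hM, (h.init 1).1, (h.init 2).1]
  have hZ0 : Z 0 = 1 := by simp [hZ, (h.init 1).2.1, (h.init 2).2.1]
  have hB0 : B 0 = Complex.I := by simp [hB, (h.init 1).2.2, (h.init 2).2.2]
  have hMle : ∀ x, ‖M x‖ ≤ 2 := by
    intro x
    have h1 := (abs_le_one_of_sq_add_sq_s14 (h.sq_add_sq_add_sq 1 x)).1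
    have h2 := (abs_le_one_of_sq_add_sq_s14 (h.sq_add_sq_add_sq 2 x)).1
    refine (norm_add_le _ _).trans ?_
    rw [norm_mul, Complex.norm_I, mul_one, Complex.norm_real, Complex.norm_real,
      Real.norm_eq_abs, Real.norm_eq_abs]
    linarith
  have hphase : ∀ (s x : ℝ), HasDerivAt
      (fun x : ℝ => Complex.exp (((s * (β * x ^ 2 / 4) : ℝ) : ℂ) * Complex.I))
      (Complex.exp (((s * (β * x ^ 2 / 4) : ℝ) : ℂ) * Complex.I) *
        ((s * (β * x / 2) : ℝ) * Complex.I)) x := by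
    intro s x
    have h1 : HasDerivAt (fun x : ℝ => s * (β * x ^ 2 / 4)) (s * (β * x / 2)) x := by
      refine (((((hasDerivAt_id x).fun_pow 2).const_mul β).div_const 4).const_mul s).congr_deriv ?_
      simp only [id_eq, Nat.cast_ofNat, Nat.add_one_sub_one, pow_one, mul_one]
      ring
    exact (h1.ofReal_comp.mul_const Complex.I).cexp
  have hkK : ∀ x, 0 ≤ x → 2 * c * ∫ t in (0 : ℝ)..x, Real.exp (-α * t ^ 2 / 4) ≤ 2 * c * K :=
    fun x hx => by
      gcongr
      exact integral_le_integral_Ioi hα hx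
  -- The two circular components of the normal plane decouple up to a term of size `k ‖M‖`.
  have hE1 : ∀ x, 0 ≤ x → ‖Complex.exp (((-1 * (β * x ^ 2 / 4) : ℝ) : ℂ) * Complex.I) *
      (Z x - Complex.I * B x) - 2‖ ≤ 2 * c * K := by
    intro x hx
    refine (norm_le_mul_integral (C := 2 * c) (f := fun x => Complex.exp
      (((-1 * (β * x ^ 2 / 4) : ℝ) : ℂ) * Complex.I) * (Z x - Complex.I * B x) - 2) (f' := fun x =>
      -(Complex.exp (((-1 * (β * x ^ 2 / 4) : ℝ) : ℂ) * Complex.I) * (k x * M x)))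
      ?_ ?_ ?_ hx).trans (hkK x hx)
    · simp [hZ0, hB0]; norm_num
    · intro y
      refine (((hphase (-1) y).fun_mul
        ((hZd y).fun_sub ((hBd y).const_mul Complex.I))).sub_const 2).congr_deriv ?_
      push_cast
      linear_combination ((Complex.exp (-1 * (β * y ^ 2 / 4) * Complex.I)) * (β * y / 2) * B y)
        * Complex.I_sq
    · intro y _
      rw [norm_neg, norm_mul, Complex.norm_exp_ofReal_mul_I, one_mul, norm_mul, Complex.norm_real,
        Real.norm_eq_abs, abs_of_pos (by positivity)]
      calc c * Real.exp (-α * y ^ 2 / 4) * ‖M y‖ ≤ c * Real.exp (-α * y ^ 2 / 4) * 2 := by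
            gcongr; exact hMle y
        _ = 2 * c * Real.exp (-α * y ^ 2 / 4) := by ring
  have hE2 : ∀ x, 0 ≤ x → ‖Complex.exp (((1 * (β * x ^ 2 / 4) : ℝ) : ℂ) * Complex.I) *
      (Z x + Complex.I * B x)‖ ≤ 2 * c * K := by
    intro x hx
    refine (norm_le_mul_integral (C := 2 * c) (f := fun x => Complex.exp
      (((1 * (β * x ^ 2 / 4) : ℝ) : ℂ) * Complex.I) * (Z x + Complex.I * B x)) (f' := fun x =>
      -(Complex.exp (((1 * (β * x ^ 2 / 4) : ℝ) : ℂ) * Complex.I) * (k x * M x)))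
      ?_ ?_ ?_ hx).trans (hkK x hx)
    · simp [hZ0, hB0]
    · intro y
      refine ((hphase 1 y).fun_mul
        ((hZd y).fun_add ((hBd y).const_mul Complex.I))).congr_deriv ?_
      push_cast
      linear_combination ((Complex.exp (1 * (β * y ^ 2 / 4) * Complex.I)) * (β * y / 2) * B y)
        * Complex.I_sq
    · intro y _
      rw [norm_neg, norm_mul, Complex.norm_exp_ofReal_mul_I, one_mul, norm_mul, Complex.norm_real,
        Real.norm_eq_abs, abs_of_pos (by positivity)]
      calc c * Real.exp (-α * y ^ 2 / 4) * ‖M y‖ ≤ c * Real.exp (-α * y ^ 2 / 4) * 2 := by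
            gcongr; exact hMle y
        _ = 2 * c * Real.exp (-α * y ^ 2 / 4) := by ring
  have hZle : ∀ x, 0 ≤ x →
      ‖Z x - Complex.exp (((1 * (β * x ^ 2 / 4) : ℝ) : ℂ) * Complex.I)‖ ≤ 2 * c * K := by
    intro x hx
    set w := Complex.exp (((1 * (β * x ^ 2 / 4) : ℝ) : ℂ) * Complex.I) with hw
    set w' := Complex.exp (((-1 * (β * x ^ 2 / 4) : ℝ) : ℂ) * Complex.I) with hw'
    have hww : w * w' = 1 := by
      rw [hw, hw', ← Complex.exp_add, ← Complex.exp_zero]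
      congr 1; push_cast; ring
    have e : Z x - w = (w * (w' * (Z x - Complex.I * B x) - 2)
        + w' * (w * (Z x + Complex.I * B x))) / 2 := by
      linear_combination (-Z x) * hww
    have n1 : ‖w‖ = 1 := Complex.norm_exp_ofReal_mul_I _
    have n2 : ‖w'‖ = 1 := Complex.norm_exp_ofReal_mul_I _
    rw [e, norm_div, Complex.norm_ofNat, div_le_iff₀ two_pos]
    refine (norm_add_le _ _).trans ?_
    rw [norm_mul, norm_mul w', n1, n2, one_mul, one_mul]
    linarith [hE1 x hx, hE2 x hx]
  have hgc : Continuous g := by fun_prop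
  have hge : ∀ x : ℝ, g x = Real.exp (-α * x ^ 2 / 4) *
      Complex.exp (((1 * (β * x ^ 2 / 4) : ℝ) : ℂ) * Complex.I) := by
    intro x
    rw [Complex.ofReal_exp, ← Complex.exp_add]
    simp only [hg]
    congr 1; push_cast; ring
  have hS : ∀ x, 0 ≤ x → ‖M x - c * ∫ t in (0 : ℝ)..x, g t‖ ≤ 2 * c ^ 2 * K ^ 2 := by
    intro x hx
    have hK0 : 0 ≤ K := integral_nonneg fun t => (Real.exp_pos _).le
    refine (norm_le_mul_integral (C := c * (2 * c * K)) (α := α)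
      (f := fun x => M x - c * ∫ t in (0 : ℝ)..x, g t)
      (f' := fun x => k x * Z x - c * g x) ?_ ?_ ?_ hx).trans ?_
    · simp [hM0]
    · intro y
      exact (hMd y).fun_sub ((intervalIntegral.integral_hasDerivAt_right
        (hgc.intervalIntegrable _ _) hgc.stronglyMeasurable.stronglyMeasurableAtFilter
        hgc.continuousAt).const_mul (c : ℂ))
    · intro y hy
      have e : (k y : ℂ) * Z y - c * g y =
          k y * (Z y - Complex.exp (((1 * (β * y ^ 2 / 4) : ℝ) : ℂ) * Complex.I)) := by
        rw [hge y]; simp only [hk]; push_cast; ring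
      rw [e, norm_mul, Complex.norm_real, Real.norm_eq_abs, abs_of_pos (by positivity)]
      calc _ ≤ k y * (2 * c * K) := by
            gcongr
            exact hZle y hy
        _ = _ := by simp only [hk]; ring
    · calc _ ≤ c * (2 * c * K) * K := by
            gcongr
            exact integral_le_integral_Ioi hα hx
        _ = _ := by ring
  have hre : 0 < ((α - β * Complex.I) / 4 : ℂ).re := by
    have : ((α - β * Complex.I) / 4 : ℂ).re = α / 4 := by
      rw [show (4 : ℂ) = ((4 : ℝ) : ℂ) by norm_num, Complex.div_ofReal_re]; simp
    rw [this]; positivity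
  have hlimg := intervalIntegral_tendsto_integral_Ioi (f := g) 0
    (integrable_cexp_neg_mul_sq hre).integrableOn tendsto_id
  have hlimM : Tendsto M atTop (𝓝 (A 1 + A 2 * Complex.I)) :=
    ((Complex.continuous_ofReal.tendsto _).comp (tendsto_coord hA 1)).add
      (((Complex.continuous_ofReal.tendsto _).comp (tendsto_coord hA 2)).mul_const Complex.I)
  refine le_of_tendsto (hlimM.sub (hlimg.const_mul (c : ℂ))).norm ?_
  filter_upwards [eventually_ge_atTop 0] with x hx using hS x hx

lemma exists_forall_small_jumpAt {α : ℝ} (hα : 0 < α) :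
    ∃ cstar : ℝ, 0 < cstar ∧ ∀ c ∈ Set.Ioo (0 : ℝ) cstar, JumpAt α c := by
  set β := √(1 - α ^ 2) with hβ
  set K : ℝ := ∫ t in Set.Ioi (0 : ℝ), Real.exp (-α * t ^ 2 / 4) with hK
  set J : ℂ := ∫ t in Set.Ioi (0 : ℝ), Complex.exp (-((α - β * Complex.I) / 4) * (t : ℂ) ^ 2)
    with hJ
  have hre : 0 < ((α - β * Complex.I) / 4 : ℂ).re := by
    have : ((α - β * Complex.I) / 4 : ℂ).re = α / 4 := by
      rw [show (4 : ℂ) = ((4 : ℝ) : ℂ) by norm_num, Complex.div_ofReal_re]; simp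
    rw [this]; positivity
  have hJ0 : J ≠ 0 := by
    rw [hJ, integral_gaussian_complex_Ioi hre]
    have hb : ((α - β * Complex.I) / 4 : ℂ) ≠ 0 := fun h => by rw [h] at hre; simp at hre
    refine div_ne_zero ?_ two_ne_zero
    rw [Ne, Complex.cpow_eq_zero_iff]
    exact fun h => div_ne_zero (by exact_mod_cast Real.pi_ne_zero) hb h.1
  have hJpos : 0 < ‖J‖ := norm_pos_iff.2 hJ0
  refine ⟨‖J‖ / (2 * K ^ 2 + 1), by positivity, ?_⟩
  rintro c ⟨hc, hcs⟩ m n b hsf A hA heq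
  obtain ⟨h1, h2⟩ := (eq_flipA_iff A).1 heq
  have h3 := hsf.norm_limit_sub_le hα hc hA
  rw [h1, h2, ← hJ, ← hK] at h3
  simp only [Complex.ofReal_zero, zero_mul, add_zero, zero_sub, norm_neg, norm_mul,
    Complex.norm_real, Real.norm_eq_abs, abs_of_pos hc] at h3
  rw [lt_div_iff₀ (by positivity)] at hcs
  have h4 : ‖J‖ ≤ c * (2 * K ^ 2) := by
    refine le_of_mul_le_mul_left ?_ hc
    linarith
  linarith

lemma abs_exp_sub_exp_le {a b : ℝ} (ha : a ≤ 0) (hb : b ≤ 0) :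
    |Real.exp a - Real.exp b| ≤ |a - b| := by
  wlog hab : b ≤ a generalizing a b
  · rw [abs_sub_comm, abs_sub_comm a]
    exact this hb ha (le_of_not_ge hab)
  rw [abs_of_nonneg (sub_nonneg.2 (Real.exp_le_exp.2 hab)), abs_of_nonneg (sub_nonneg.2 hab)]
  have h1 := Real.add_one_le_exp (b - a)
  have h2 : Real.exp b = Real.exp a * Real.exp (b - a) := by rw [← Real.exp_add]; congr 1; ring
  have h3 : Real.exp a ≤ 1 := Real.exp_le_one_iff.2 ha
  rw [h2]
  nlinarith [Real.exp_pos a]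

/-- Closeness on `[0, X]` of the coefficients of the systems with parameters `α` and `α'`. -/
lemma abs_coeff_sub_le {c α α' β β' X : ℝ} (hc : 0 ≤ c) (hα : 0 ≤ α) (hα' : 0 ≤ α') :
    ∀ x ∈ Set.Icc 0 X, |c * Real.exp (-α * x ^ 2 / 4) - c * Real.exp (-α' * x ^ 2 / 4)|
      + |β * x / 2 - β' * x / 2| ≤ c * (|α - α'| * X ^ 2 / 4) + |β - β'| * X / 2 := by
  rintro x ⟨hx0, hxX⟩
  have h1 : |Real.exp (-α * x ^ 2 / 4) - Real.exp (-α' * x ^ 2 / 4)| ≤ |α - α'| * X ^ 2 / 4 := by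
    refine (abs_exp_sub_exp_le ?_ ?_).trans ?_
    · have : 0 ≤ α * x ^ 2 := by positivity
      linarith
    · have : 0 ≤ α' * x ^ 2 := by positivity
      linarith
    · rw [show -α * x ^ 2 / 4 - -α' * x ^ 2 / 4 = (α' - α) * (x ^ 2 / 4) by ring, abs_mul,
        abs_sub_comm, abs_of_nonneg (by positivity : 0 ≤ x ^ 2 / 4), mul_div_assoc]
      gcongr
  have h2 : |β * x / 2 - β' * x / 2| ≤ |β - β'| * X / 2 := by
    rw [show β * x / 2 - β' * x / 2 = (β - β') * (x / 2) by ring, abs_mul,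
      abs_of_nonneg (by positivity : 0 ≤ x / 2), mul_div_assoc]
    gcongr
  rw [← mul_sub, abs_mul, abs_of_nonneg hc]
  gcongr

/-- For `α` near `α'` the coefficients of the two systems are uniformly close on `[0, X]`. -/
lemma eventually_coeff_close (c α' X : ℝ) {δ : ℝ} (hδ : 0 < δ) :
    ∀ᶠ α in 𝓝 α', c * (|α - α'| * X ^ 2 / 4) + |√(1 - α ^ 2) - √(1 - α' ^ 2)| * X / 2 < δ := by
  have hcont : Continuous fun α : ℝ =>
      c * (|α - α'| * X ^ 2 / 4) + |√(1 - α ^ 2) - √(1 - α' ^ 2)| * X / 2 := by fun_prop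
  have h := hcont.tendsto α'
  simp only [sub_self, abs_zero, zero_mul, zero_div, mul_zero, add_zero] at h
  exact h.eventually_lt_const hδ

lemma exists_forall_jumpAt_of_near_zero {c : ℝ} (hc : 0 < c) :
    ∃ α₀ : ℝ, 0 < α₀ ∧ ∀ α : ℝ, α ∈ Set.Ioo (0 : ℝ) α₀ → α ≤ 1 → JumpAt α c := by
  obtain ⟨P, Q, R, ρ, hρ, hsol, hn, h0, hQ, hR⟩ := exists_sfSol_const_curvature hc
  obtain ⟨X, hX, δ, hδ, key⟩ := hsol.exists_abs_limit_ne_one (C := 8 * c) hρ hn h0 hQ hR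
  obtain ⟨ε, hε, hclose⟩ := Metric.eventually_nhds_iff.1 (eventually_coeff_close c 0 X hδ)
  refine ⟨min ε (1 / 2), by positivity, ?_⟩
  rintro α ⟨hα0, hα1⟩ -
  have hαε : α < ε := hα1.trans_le (min_le_left _ _)
  have hα2 : α < 1 / 2 := hα1.trans_le (min_le_right _ _)
  have hβ : 1 / 2 ≤ √(1 - α ^ 2) := Real.le_sqrt_of_sq_le (by nlinarith)
  refine jumpAt_of_abs_limit_ne_one fun m n b hsf A hA => ?_
  refine key _ _ _ _ _ (A 0) (hsf.sfSol 0) (by simp [hsf.init 0]) (by simp [hsf.init 0])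
    (by simp [hsf.init 0]) ?_ ?_ (tendsto_coord hA 0)
  · intro x hx
    have h1 := abs_coeff_sub_le (α' := 0) (β := √(1 - α ^ 2)) (β' := √(1 - 0 ^ 2)) hc.le hα0.le
      le_rfl x hx
    have h2 := hclose (y := α) (by rw [Real.dist_eq, sub_zero, abs_of_pos hα0]; exact hαε)
    refine le_trans (le_of_eq ?_) (h1.trans h2.le)
    simp
  · intro y hy
    refine ((hsf.sfSol 0).tail_of_torsion hc hα0.le (by linarith)
      (fun x => (abs_le_one_of_sq_add_sq_s14 (hsf.sq_add_sq_add_sq 0 x)).2.2) hX hy).trans ?_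
    gcongr
    rw [div_le_iff₀ (by linarith)]
    nlinarith

lemma exists_forall_jumpAt_of_near_one {c : ℝ} (hc : 0 < c) (hcπ : ∀ k : ℕ, c ≠ k * √π) :
    ∃ α₁ ∈ Set.Ioo (0 : ℝ) 1, ∀ α ∈ Set.Ioo α₁ (1 : ℝ), JumpAt α c := by
  obtain ⟨P, Q, R, hsol, hn, h0, hQ, hR⟩ := exists_sfSol_zero_torsion hc hcπ
  obtain ⟨X, hX, δ, hδ, key⟩ := hsol.exists_abs_limit_ne_one (C := 8 * c) zero_le_one hn h0 hQ hR
  obtain ⟨ε, hε, hclose⟩ := Metric.eventually_nhds_iff.1 (eventually_coeff_close c 1 X hδ)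
  refine ⟨max (1 - ε) (1 / 2), ⟨lt_max_of_lt_right (by norm_num),
    max_lt (by linarith) (by norm_num)⟩, ?_⟩
  rintro α ⟨hα0, hα1⟩
  have hαε : 1 - ε < α := (le_max_left _ _).trans_lt hα0
  have hα2 : 1 / 2 < α := (le_max_right _ _).trans_lt hα0
  refine jumpAt_of_abs_limit_ne_one fun m n b hsf A hA => ?_
  refine key _ _ _ _ _ (A 0) (hsf.sfSol 0) (by simp [hsf.init 0]) (by simp [hsf.init 0])
    (by simp [hsf.init 0]) ?_ ?_ (tendsto_coord hA 0)
  · intro x hx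
    have h1 := abs_coeff_sub_le (α := α) (α' := 1) (β := √(1 - α ^ 2)) (β' := √(1 - 1 ^ 2))
      hc.le (by linarith) zero_le_one x hx
    have h2 := hclose (y := α) (by rw [Real.dist_eq, abs_lt]; constructor <;> linarith)
    refine le_trans (le_of_eq ?_) (h1.trans h2.le)
    simp
  · exact fun y hy => (hsf.sfSol 0).tail_of_curvature hc hα2.le
      (fun x => (abs_le_one_of_sq_add_sq_s14 (hsf.sq_add_sq_add_sq 0 x)).2.1) hX hy

/-- the initial condition of the self-similar solution `m_{c,α}` has a genuine
jump (`A⁺_{c,α} ≠ A⁻_{c,α}`) (1) for every `α ∈ (0,1]` and `c` small, (2) for every `c > 0`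
and `α` small, and (3) for every `c > 0` with `c ∉ ℕ√π` and `α` close to `1`. -/
theorem expander_jump_discontinuity :
    (∀ α ∈ Set.Ioc (0 : ℝ) 1, ∃ cstar : ℝ, 0 < cstar ∧
      ∀ c ∈ Set.Ioo (0 : ℝ) cstar, JumpAt α c) ∧
    (∀ c : ℝ, 0 < c → ∃ α₀ : ℝ, 0 < α₀ ∧
      ∀ α : ℝ, α ∈ Set.Ioo (0 : ℝ) α₀ → α ≤ 1 → JumpAt α c) ∧
    (∀ c : ℝ, 0 < c → (∀ k : ℕ, c ≠ k * Real.sqrt π) →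
      ∃ α₁ ∈ Set.Ioo (0 : ℝ) 1, ∀ α ∈ Set.Ioo α₁ (1 : ℝ), JumpAt α c) :=
  ⟨fun _ hα => exists_forall_small_jumpAt hα.1, fun _ => exists_forall_jumpAt_of_near_zero,
    fun _ => exists_forall_jumpAt_of_near_one⟩
end
end

section
/- Let α ∈ [0,1], β = √(1−α²), c > 0, and define u_{c,α}(x,t) = (c/√t) e^{(−α+iβ) x²/(4t)} for (x,t) ∈ ℝ × (0,∞). Then: (i) u_{c,α} satisfies pointwise on ℝ × (0,∞) the nonlocal dissipative Schrödinger equation i ∂ₜu + (β − iα) ∂ₓₓu + (u/2)( β|u|² + 2α ∫₀^x Im(ū ∂ₓu)(y,t) dy − βc²/t ) = 0; and (ii) u_{c,α}(·,t) converges, as t → 0⁺, to 2c √(π(α+iβ)) δ₀ in the space of tempered distributions, i.e. for every Schwartz function φ : ℝ → ℂ, ∫_ℝ u_{c,α}(x,t) φ(x) dx → 2c √(π(α+iβ)) φ(0), where √ denotes the principal branch of the complex square root. -/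
noncomputable section

open Real MeasureTheory Filter Topology

open scoped FourierTransform

/-- Parseval's identity against a Gaussian with `0 < b.re`. -/
lemma integral_gaussian_mul_fourier_of_re_pos {b : ℂ} (hb : 0 < b.re) (ψ : SchwartzMap ℝ ℂ) :
    ∫ x : ℝ, Complex.exp (-π * b * x ^ 2) * 𝓕 ψ x =
      1 / b ^ (1 / 2 : ℂ) * ∫ x : ℝ, Complex.exp (-π / b * x ^ 2) * ψ x := by
  have hint : Integrable fun x : ℝ => Complex.exp (-π * b * x ^ 2) := by
    simpa using integrable_cexp_quadratic' (b := -π * b) (by simpa using mul_pos pi_pos hb) 0 0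
  have h := VectorFourier.integral_fourierIntegral_smul_eq_flip (L := innerₗ ℝ)
    Real.continuous_fourierChar continuous_inner hint (ψ.integrable (μ := volume))
  have e : VectorFourier.fourierIntegral Real.fourierChar volume (innerₗ ℝ)
      (fun x : ℝ => Complex.exp (-π * b * x ^ 2)) =
      fun t : ℝ => 1 / b ^ (1 / 2 : ℂ) * Complex.exp (-π / b * t ^ 2) := fourier_gaussian_pi hb
  rw [flip_innerₗ, e] at h
  rw [← integral_const_mul]
  simp only [smul_eq_mul, mul_assoc] at h ⊢
  exact h.symm

lemma norm_cexp_mul_sq_le_one {z : ℂ} (hz : z.re ≤ 0) (x : ℝ) :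
    ‖Complex.exp (z * x ^ 2)‖ ≤ 1 := by
  rw [Complex.norm_exp, Real.exp_le_one_iff, ← Complex.ofReal_pow, Complex.re_mul_ofReal]
  exact mul_nonpos_of_nonpos_of_nonneg hz (sq_nonneg x)

/-- Continuity of a Gaussian pairing in the Gaussian parameter, up to the oscillatory case. -/
lemma tendsto_integral_cexp_mul_sq {ι : Type*} {l : Filter ι} [l.IsCountablyGenerated]
    {z : ι → ℂ} {z₀ : ℂ} (hz : Tendsto z l (𝓝 z₀)) (hre : ∀ᶠ i in l, (z i).re ≤ 0)
    {f : ℝ → ℂ} (hf : Integrable f) :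
    Tendsto (fun i => ∫ x : ℝ, Complex.exp (z i * x ^ 2) * f x) l
      (𝓝 (∫ x : ℝ, Complex.exp (z₀ * x ^ 2) * f x)) := by
  refine tendsto_integral_filter_of_dominated_convergence (fun x => ‖f x‖) ?_ ?_ hf.norm ?_
  · exact Eventually.of_forall fun i =>
      (by fun_prop : Continuous fun x : ℝ => Complex.exp (z i * x ^ 2)).aestronglyMeasurable.mul
        hf.aestronglyMeasurable
  · filter_upwards [hre] with i hi
    refine Eventually.of_forall fun x => ?_
    rw [norm_mul]
    exact mul_le_of_le_one_left (norm_nonneg _) (norm_cexp_mul_sq_le_one hi x)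
  · exact Eventually.of_forall fun x =>
      ((Complex.continuous_exp.tendsto _).comp (hz.mul_const _)).mul_const _

/-- Parseval's identity against a possibly oscillatory Gaussian. -/
lemma integral_gaussian_mul_fourier {b : ℂ} (hb : 0 ≤ b.re) (hb0 : b ≠ 0)
    (ψ : SchwartzMap ℝ ℂ) :
    ∫ x : ℝ, Complex.exp (-π * b * x ^ 2) * 𝓕 ψ x =
      1 / b ^ (1 / 2 : ℂ) * ∫ x : ℝ, Complex.exp (-π / b * x ^ 2) * ψ x := by
  have hslit : b ∈ Complex.slitPlane := by
    rw [Complex.mem_slitPlane_iff]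
    rcases hb.lt_or_eq with h | h
    · exact Or.inl h
    · exact Or.inr fun h' => hb0 (Complex.ext h.symm h')
  have hlim : Tendsto (fun ε : ℝ => b + ε) (𝓝[>] 0) (𝓝 b) := by
    have : Tendsto (fun ε : ℝ => b + ε) (𝓝 0) (𝓝 (b + (0 : ℝ))) :=
      Continuous.tendsto (by fun_prop) 0
    rw [Complex.ofReal_zero, add_zero] at this
    exact this.mono_left nhdsWithin_le_nhds
  have hpos : ∀ᶠ ε : ℝ in 𝓝[>] 0, 0 < (b + ε).re := by
    filter_upwards [self_mem_nhdsWithin] with ε hε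
    simpa using add_pos_of_nonneg_of_pos hb hε
  have h₁ := tendsto_integral_cexp_mul_sq (hlim.const_mul (-π : ℂ))
    (hpos.mono fun ε hε => by simpa using (mul_pos pi_pos hε).le)
    ((𝓕 ψ).integrable (μ := volume))
  have h₂ := tendsto_integral_cexp_mul_sq ((tendsto_const_nhds (x := (-π : ℂ))).div hlim hb0)
    (hpos.mono fun ε hε => by
      change ((-π : ℂ) / (b + ε)).re ≤ 0
      rw [div_eq_mul_inv, ← Complex.ofReal_neg, Complex.re_ofReal_mul, Complex.inv_re, neg_mul]
      exact neg_nonpos.mpr (mul_nonneg pi_pos.le (div_nonneg hε.le (Complex.normSq_nonneg _))))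
    (ψ.integrable (μ := volume))
  have h₃ : Tendsto (fun ε : ℝ => 1 / (b + ε) ^ (1 / 2 : ℂ)) (𝓝[>] 0)
      (𝓝 (1 / b ^ (1 / 2 : ℂ))) :=
    (tendsto_const_nhds (x := (1 : ℂ))).div
      (hlim.cpow tendsto_const_nhds hslit) (by simp [Complex.cpow_eq_zero_iff, hb0])
  refine tendsto_nhds_unique h₁ ((h₃.mul h₂).congr' ?_)
  filter_upwards [hpos] with ε hε
  exact (integral_gaussian_mul_fourier_of_re_pos hε ψ).symm

lemma ofReal_mul_cpow_half {r : ℝ} (hr : 0 < r) {z : ℂ} (hz : z ≠ 0) :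
    ((r : ℂ) * z) ^ (1 / 2 : ℂ) = (√r : ℝ) * z ^ (1 / 2 : ℂ) := by
  have hr' : (r : ℂ) ≠ 0 := Complex.ofReal_ne_zero.mpr hr.ne'
  rw [Complex.cpow_def_of_ne_zero (mul_ne_zero hr' hz), Complex.cpow_def_of_ne_zero hz,
    Complex.log_ofReal_mul hr hz, add_mul, Complex.exp_add, Real.sqrt_eq_rpow,
    Real.rpow_def_of_pos hr]
  push_cast
  rfl

/-- Gaussians of complex variance `2 z t` with `0 ≤ z.re` concentrate at the origin. -/
lemma tendsto_gaussian_delta {z : ℂ} (hz : 0 ≤ z.re) (hz0 : z ≠ 0) (φ : SchwartzMap ℝ ℂ) :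
    Tendsto (fun t : ℝ => ((√t)⁻¹ : ℝ) * ∫ x : ℝ, Complex.exp (-(x : ℂ) ^ 2 / (4 * z * t)) * φ x)
      (𝓝[>] 0) (𝓝 (2 * (π * z) ^ (1 / 2 : ℂ) * φ 0)) := by
  set ψ : SchwartzMap ℝ ℂ := 𝓕⁻ φ
  have hψ : 𝓕 ψ = φ := FourierTransform.fourier_fourierInv_eq φ
  have hφ0 : ∫ x : ℝ, ψ x = φ 0 := by
    rw [← hψ, SchwartzMap.fourier_coe, Real.fourier_eq]
    simp
  have hlim : Tendsto (fun t : ℝ => -π * (4 * π * t * z)) (𝓝[>] 0) (𝓝 (0 : ℂ)) := by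
    have : Tendsto (fun t : ℝ => -π * (4 * π * t * z)) (𝓝 0) (𝓝 (-π * (4 * π * (0 : ℝ) * z))) :=
      Continuous.tendsto (by fun_prop) 0
    simp only [Complex.ofReal_zero, mul_zero, zero_mul] at this
    exact this.mono_left nhdsWithin_le_nhds
  have h := tendsto_integral_cexp_mul_sq hlim (f := ψ) (by
    filter_upwards [self_mem_nhdsWithin] with t (ht : 0 < t)
    have : (-π * (4 * π * t * z) : ℂ) = ((-π * (4 * π * t) : ℝ) : ℂ) * z := by
      push_cast; ring
    rw [this, Complex.re_ofReal_mul]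
    exact mul_nonpos_of_nonpos_of_nonneg (by nlinarith [mul_pos pi_pos (mul_pos pi_pos ht)]) hz)
    ψ.integrable
  simp only [zero_mul, Complex.exp_zero, one_mul, hφ0] at h
  refine (h.const_mul (2 * (π * z) ^ (1 / 2 : ℂ))).congr' ?_
  filter_upwards [self_mem_nhdsWithin] with t (ht : 0 < t)
  have hr : 0 < (4 * π * t)⁻¹ := by positivity
  have hπ : (π : ℂ) ≠ 0 := Complex.ofReal_ne_zero.mpr pi_ne_zero
  have ht' : (t : ℂ) ≠ 0 := Complex.ofReal_ne_zero.mpr ht.ne'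
  have key := integral_gaussian_mul_fourier (b := ((4 * π * t)⁻¹ : ℝ) * z⁻¹)
    (by
      rw [Complex.re_ofReal_mul, Complex.inv_re]
      exact mul_nonneg hr.le (div_nonneg hz (Complex.normSq_nonneg _)))
    (mul_ne_zero (Complex.ofReal_ne_zero.mpr hr.ne') (inv_ne_zero hz0)) ψ
  have harg : z.arg ≠ π := fun h => by
    obtain ⟨h₁, -⟩ := Complex.arg_eq_pi_iff.mp h
    exact h₁.not_ge hz
  rw [hψ, ofReal_mul_cpow_half hr (inv_ne_zero hz0), Complex.inv_cpow _ _ harg] at key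
  have e₁ : ∀ x : ℝ, -(x : ℂ) ^ 2 / (4 * z * t) =
      -π * (((4 * π * t)⁻¹ : ℝ) * z⁻¹) * (x : ℂ) ^ 2 := fun x => by
    push_cast; field_simp
  have e₂ : -π / ((((4 * π * t)⁻¹ : ℝ) : ℂ) * z⁻¹) = -π * (4 * π * t * z) := by
    push_cast; field_simp
  simp only [e₁]
  rw [key, e₂, ofReal_mul_cpow_half pi_pos hz0]
  have hs : √((4 * π * t)⁻¹) = (2 * √π * √t)⁻¹ := by
    rw [Real.sqrt_inv, Real.sqrt_mul (by positivity), Real.sqrt_mul (by positivity),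
      show (4 : ℝ) = 2 ^ 2 by norm_num, Real.sqrt_sq (by norm_num)]
  have hst : (√t : ℂ) ≠ 0 := Complex.ofReal_ne_zero.mpr (Real.sqrt_ne_zero'.mpr ht)
  rw [hs]
  push_cast
  field_simp

/-- The space derivative of `(c / √t) * exp (l * x ^ 2 / (4 * t))`. -/
lemma hasDerivAt_selfSimilar_space (c t : ℝ) (l : ℂ) (x : ℝ) :
    HasDerivAt (fun y : ℝ => ((c / √t : ℝ) : ℂ) * Complex.exp (l * (y : ℂ) ^ 2 / (4 * (t : ℂ))))
      (l * x / (2 * t) * (((c / √t : ℝ) : ℂ) * Complex.exp (l * (x : ℂ) ^ 2 / (4 * (t : ℂ))))) x := by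
  have h : HasDerivAt (fun y : ℝ => l * (y : ℂ) ^ 2 / (4 * (t : ℂ)))
      (l * (2 * x) / (4 * t)) x := by
    have := (((hasDerivAt_id (x : ℂ)).comp_ofReal.pow 2).const_mul l).div_const (4 * (t : ℂ))
    simpa using this
  convert! (h.cexp).const_mul ((c / √t : ℝ) : ℂ) using 1
  rw [show l * (2 * x) / (4 * t) = l * x / (2 * (t : ℂ)) by
    rw [show l * (2 * x) = 2 * (l * x) by ring, show (4 : ℂ) * t = 2 * (2 * t) by ring,
      mul_div_mul_left _ _ two_ne_zero]]
  ring

/-- The time derivative of `(c / √t) * exp (l * x ^ 2 / (4 * t))`. -/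
lemma hasDerivAt_selfSimilar_time (c x : ℝ) (l : ℂ) {t : ℝ} (ht : 0 < t) :
    HasDerivAt (fun s : ℝ => ((c / √s : ℝ) : ℂ) * Complex.exp (l * (x : ℂ) ^ 2 / (4 * (s : ℂ))))
      ((-1 / (2 * t) - l * x ^ 2 / (4 * t ^ 2)) *
        (((c / √t : ℝ) : ℂ) * Complex.exp (l * (x : ℂ) ^ 2 / (4 * (t : ℂ))))) t := by
  have ht' : (t : ℂ) ≠ 0 := Complex.ofReal_ne_zero.mpr ht.ne'
  have hs : √t ≠ 0 := Real.sqrt_ne_zero'.mpr ht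
  have h₁ : HasDerivAt (fun s : ℝ => l * (x : ℂ) ^ 2 / (4 * (s : ℂ)))
      (-(l * x ^ 2 / (4 * t ^ 2))) t := by
    have h₀ := (((hasDerivAt_id (t : ℂ)).comp_ofReal.const_mul (4 : ℂ)).fun_inv
      (by simpa using ht')).const_mul (l * (x : ℂ) ^ 2)
    simp only [id, ← div_eq_mul_inv] at h₀
    convert! h₀ using 1
    field_simp
  have h₂ : HasDerivAt (fun s : ℝ => c / √s) (-1 / (2 * t) * (c / √t)) t := by
    have h₀ := ((Real.hasDerivAt_sqrt ht.ne').fun_inv hs).const_mul c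
    simp only [← div_eq_mul_inv] at h₀
    convert! h₀ using 1
    rw [Real.sq_sqrt ht.le]
    field_simp
  convert! h₂.ofReal_comp.mul h₁.cexp using 1
  push_cast
  ring

/-- the filament function `u_{c,α}(x,t) = (c/√t) e^{(-α+iβ)x²/(4t)}` solves the
nonlocal dissipative Schrödinger equation pointwise on `ℝ × (0,∞)`, and converges as
`t → 0⁺` to `2c √(π(α+iβ)) δ₀` in the sense of tempered distributions. -/
theorem filament_function_equation_and_delta_limit
    (α β c : ℝ) (hα : α ∈ Set.Icc (0 : ℝ) 1) (hβ : β = Real.sqrt (1 - α ^ 2)) (hc : 0 < c)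
    (u : ℝ → ℝ → ℂ)
    (hu : ∀ x t : ℝ, u x t =
      ((c / Real.sqrt t : ℝ) : ℂ) *
        Complex.exp ((-(α : ℂ) + Complex.I * (β : ℂ)) * (x : ℂ) ^ 2 / (4 * (t : ℂ)))) :
    (∀ x : ℝ, ∀ t : ℝ, 0 < t →
      Complex.I * deriv (fun s => u x s) t
        + ((β : ℂ) - Complex.I * (α : ℂ)) * deriv (deriv (fun y => u y t)) x
        + (u x t / 2) *
            ((β : ℂ) * ((Complex.normSq (u x t) : ℝ) : ℂ)
              + 2 * (α : ℂ) *
                  ((∫ y in (0 : ℝ)..x,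
                      ((starRingEnd ℂ) (u y t) * deriv (fun z => u z t) y).im : ℝ) : ℂ)
              - ((β * c ^ 2 / t : ℝ) : ℂ)) = 0) ∧
    (∀ φ : SchwartzMap ℝ ℂ,
      Tendsto (fun t : ℝ => ∫ x : ℝ, u x t * φ x) (nhdsWithin 0 (Set.Ioi 0))
        (nhds ((2 * c : ℂ) * (((π : ℝ) : ℂ) * ((α : ℂ) + Complex.I * (β : ℂ))) ^ ((1 : ℂ) / 2)
          * φ 0))) := by
  set l : ℂ := -(α : ℂ) + Complex.I * (β : ℂ) with hl
  have hαβ : α ^ 2 + β ^ 2 = 1 := by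
    rw [hβ, Real.sq_sqrt (by nlinarith [hα.1, hα.2])]
    ring
  have hαβ' : (α : ℂ) ^ 2 + (β : ℂ) ^ 2 = 1 := by exact_mod_cast hαβ
  obtain rfl : u = fun (x t : ℝ) =>
      ((c / √t : ℝ) : ℂ) * Complex.exp (l * (x : ℂ) ^ 2 / (4 * (t : ℂ))) :=
    funext₂ hu
  refine ⟨fun x t ht => ?_, fun φ => ?_⟩
  · have hx := fun y => hasDerivAt_selfSimilar_space c t l y
    have hnorm (y : ℝ) : Complex.normSq (((c / √t : ℝ) : ℂ) *
        Complex.exp (l * (y : ℂ) ^ 2 / (4 * (t : ℂ)))) =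
        c ^ 2 / t * Real.exp (-α * y ^ 2 / (2 * t)) := by
      have hre : (l * (y : ℂ) ^ 2 / (4 * (t : ℂ))).re = -α * y ^ 2 / (4 * t) := by
        rw [show l * (y : ℂ) ^ 2 / (4 * (t : ℂ)) = l * ((y ^ 2 / (4 * t) : ℝ) : ℂ) by
          push_cast; ring, Complex.re_mul_ofReal]
        simp [hl]
        ring
      rw [Complex.normSq_mul, Complex.normSq_ofReal, Complex.normSq_eq_norm_sq,
        Complex.norm_exp, hre, ← Real.exp_nat_mul, ← sq, div_pow, Real.sq_sqrt ht.le]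
      congr 2
      push_cast
      field_simp
      ring
    have him (y : ℝ) : ((starRingEnd ℂ) (((c / √t : ℝ) : ℂ) *
        Complex.exp (l * (y : ℂ) ^ 2 / (4 * (t : ℂ)))) *
        deriv (fun z : ℝ => ((c / √t : ℝ) : ℂ) *
          Complex.exp (l * (z : ℂ) ^ 2 / (4 * (t : ℂ)))) y).im =
        β * y / (2 * t) * (c ^ 2 / t * Real.exp (-α * y ^ 2 / (2 * t))) := by
      rw [(hx y).deriv, mul_left_comm, ← Complex.normSq_eq_conj_mul_self, hnorm,
        Complex.im_mul_ofReal, show l * y / (2 * t) = l * ((y / (2 * t) : ℝ) : ℂ) by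
          push_cast; ring, Complex.im_mul_ofReal, show l.im = β by simp [hl]]
      ring
    have hI : 2 * α * ∫ y in (0 : ℝ)..x,
        β * y / (2 * t) * (c ^ 2 / t * Real.exp (-α * y ^ 2 / (2 * t))) =
        β * c ^ 2 / t - β * (c ^ 2 / t * Real.exp (-α * x ^ 2 / (2 * t))) := by
      rw [← intervalIntegral.integral_const_mul]
      have hF (y : ℝ) : HasDerivAt
          (fun y : ℝ => -β * (c ^ 2 / t * Real.exp (-α * y ^ 2 / (2 * t))))
          (2 * α * (β * y / (2 * t) * (c ^ 2 / t * Real.exp (-α * y ^ 2 / (2 * t))))) y := by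
        have h := (((((hasDerivAt_pow 2 y).const_mul (-α)).div_const (2 * t)).exp.const_mul
          (c ^ 2 / t)).const_mul (-β))
        convert! h using 1
        push_cast
        ring
      rw [intervalIntegral.integral_eq_sub_of_hasDerivAt (fun y _ => hF y)
        (Continuous.intervalIntegrable (by fun_prop) _ _)]
      simp
      ring
    have hIc := congrArg (fun r : ℝ => (r : ℂ)) hI
    have hxx : deriv (deriv fun y : ℝ => ((c / √t : ℝ) : ℂ) *
        Complex.exp (l * (y : ℂ) ^ 2 / (4 * (t : ℂ)))) x =
        (l / (2 * t) + l ^ 2 * x ^ 2 / (4 * t ^ 2)) * (((c / √t : ℝ) : ℂ) *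
          Complex.exp (l * (x : ℂ) ^ 2 / (4 * (t : ℂ)))) := by
      rw [funext fun y => (hx y).deriv]
      have h := (((hasDerivAt_id (x : ℂ)).comp_ofReal.const_mul l).div_const (2 * (t : ℂ))).mul
        (hx x)
      refine h.deriv.trans ?_
      simp only [id]
      ring
    simp only [him, hnorm]
    rw [(hasDerivAt_selfSimilar_time c x l ht).deriv, hxx]
    simp only [Complex.ofReal_mul, Complex.ofReal_sub, Complex.ofReal_ofNat] at hIc
    rw [hIc]
    have hlin : Complex.I * (-1 / (2 * t) - l * x ^ 2 / (4 * t ^ 2)) +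
        ((β : ℂ) - Complex.I * α) * (l / (2 * t) + l ^ 2 * x ^ 2 / (4 * t ^ 2)) = 0 := by
      have hmul : ((β : ℂ) - Complex.I * α) * l = Complex.I := by
        rw [hl]
        linear_combination Complex.I * hαβ' - α * β * Complex.I_sq
      linear_combination (1 / (2 * t) + l * x ^ 2 / (4 * t ^ 2)) * hmul
    push_cast
    linear_combination (c / √t * Complex.exp (l * (x : ℂ) ^ 2 / (4 * (t : ℂ)))) * hlin
  · set z : ℂ := (α : ℂ) + Complex.I * β with hz
    have hzl : z * l = -1 := by
      rw [hz, hl]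
      linear_combination -hαβ' + β ^ 2 * Complex.I_sq
    have hz0 : z ≠ 0 := fun h => by simp [h] at hzl
    have h := (tendsto_gaussian_delta (z := z) (by simpa [hz] using hα.1) hz0 φ).const_mul (c : ℂ)
    refine Tendsto.congr' ?_ (by convert h using 2; ring)
    filter_upwards [self_mem_nhdsWithin] with t (ht : 0 < t)
    have ht' : (t : ℂ) ≠ 0 := Complex.ofReal_ne_zero.mpr ht.ne'
    have e (x : ℝ) : l * (x : ℂ) ^ 2 / (4 * (t : ℂ)) = -(x : ℂ) ^ 2 / (4 * z * t) := by
      field_simp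
      linear_combination (x : ℂ) ^ 2 * hzl
    simp only [e, mul_assoc, integral_const_mul]
    push_cast
    ring
end
end
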